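/- Let u : ℝ × [0,∞) → ℝ be a smooth function, 2π-periodic in its first variable, with u(θ,t) > 0 everywhere, satisfying the normalized affine flow ∂_t u = (1/4)(κ − κ̄)·u with κ(θ,t) = u³·(∂²_θ u + u), κ̄(t) = (∫_0^{2π} κ u^{−2} dθ)/(∫_0^{2π} u^{−2} dθ), ∫_0^{2π} u(θ,0)^{−2} dθ = 2π, and satisfying the orthogonality condition ∫_0^{2π} u(θ,0)^{−3} cos θ dθ = ∫_0^{2π} u(θ,0)^{−3} sin θ dθ = 0. Then there exist constants C > 0 and a > 0 such that ∫_0^{2π} ( κ(θ,t) − κ̄(t) )²·u(θ,t)^{−2} dθ ≤ C·e^{−a t} for all t ≥ 0. -/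

import Mathlib

open Real MeasureTheory

lemma norm_sq_fourierCoeffOn_ofReal {f : ℝ → ℝ} (hf : Continuous f) (n : ℤ) :
    ‖fourierCoeffOn Real.two_pi_pos (fun x => (f x : ℂ)) n‖ ^ 2 =
      ((∫ x in (0 : ℝ)..(2 * π), f x * cos (n * x)) ^ 2 +
        (∫ x in (0 : ℝ)..(2 * π), f x * sin (n * x)) ^ 2) / (2 * π) ^ 2 := by
  have hpt : ∀ x : ℝ, fourier (-n) (x : AddCircle (2 * π - 0)) • (f x : ℂ) =
      ((f x * cos (n * x) : ℝ) : ℂ) - ((f x * sin (n * x) : ℝ) : ℂ) * Complex.I := by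
    intro x
    have hpi : (π : ℂ) ≠ 0 := by exact_mod_cast Real.pi_ne_zero
    have harg : 2 * π * Complex.I * ((-n : ℤ) : ℂ) * x / ((2 * π - 0 : ℝ) : ℂ) =
        ((-(n * x) : ℝ) : ℂ) * Complex.I := by
      push_cast
      field_simp
      ring
    rw [fourier_coe_apply, harg, Complex.exp_mul_I, ← Complex.ofReal_cos, ← Complex.ofReal_sin,
      Real.cos_neg, Real.sin_neg, smul_eq_mul]
    push_cast
    ring
  rw [fourierCoeffOn_eq_integral]
  simp_rw [hpt]
  rw [intervalIntegral.integral_sub, intervalIntegral.integral_mul_const,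
    intervalIntegral.integral_ofReal, intervalIntegral.integral_ofReal, norm_smul, mul_pow,
    Complex.sq_norm, Complex.normSq_apply]
  · simp
    field_simp
    rw [sq_abs]
  · exact Continuous.intervalIntegrable (by fun_prop) _ _
  · exact Continuous.intervalIntegrable (by fun_prop) _ _

lemma hasSum_norm_sq_fourierCoeffOn_ofReal {f : ℝ → ℝ} (hf : Continuous f) :
    HasSum (fun n : ℤ => ‖fourierCoeffOn Real.two_pi_pos (fun x => (f x : ℂ)) n‖ ^ 2)
      ((2 * π)⁻¹ * ∫ x in (0 : ℝ)..(2 * π), f x ^ 2) := by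
  have hmem : MemLp (fun x => (f x : ℂ)) 2 (volume.restrict (Set.Ioc 0 (2 * π))) := by
    have hc : Continuous (fun x => (f x : ℂ)) := by fun_prop
    obtain ⟨M, hM⟩ := (isCompact_Icc (a := (0 : ℝ)) (b := 2 * π)).exists_bound_of_continuousOn
      hc.continuousOn
    refine MemLp.of_bound hc.aestronglyMeasurable M ?_
    refine (ae_restrict_iff' measurableSet_Ioc).2 (Filter.Eventually.of_forall fun x hx => ?_)
    exact hM x ⟨hx.1.le, hx.2⟩
  simpa using hasSum_sq_fourierCoeffOn Real.two_pi_pos hmem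

lemma norm_sq_fourierCoeffOn_deriv {f f' : ℝ → ℝ} (hf : ∀ x, HasDerivAt f (f' x) x)
    (hf' : Continuous f') (hper : f (2 * π) = f 0) (n : ℤ) :
    ‖fourierCoeffOn Real.two_pi_pos (fun x => (f' x : ℂ)) n‖ ^ 2 =
      n ^ 2 * ‖fourierCoeffOn Real.two_pi_pos (fun x => (f x : ℂ)) n‖ ^ 2 := by
  rcases eq_or_ne n 0 with rfl | hn
  · rw [norm_sq_fourierCoeffOn_ofReal hf']
    have : ∫ x in (0 : ℝ)..(2 * π), f' x = 0 := by
      rw [intervalIntegral.integral_eq_sub_of_hasDerivAt (fun x _ => hf x)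
        (hf'.intervalIntegrable _ _), hper, sub_self]
    simp [this]
  · have h := fourierCoeffOn_of_hasDerivAt Real.two_pi_pos hn
      (f := fun x => (f x : ℂ)) (f' := fun x => (f' x : ℂ))
      (fun x _ => (hf x).ofReal_comp) (Continuous.intervalIntegrable (by fun_prop) _ _)
    have hpi : (π : ℂ) ≠ 0 := by exact_mod_cast Real.pi_ne_zero
    have hn' : (n : ℂ) ≠ 0 := by exact_mod_cast hn
    have h2 : fourierCoeffOn Real.two_pi_pos (fun x => (f' x : ℂ)) n =
        Complex.I * n * fourierCoeffOn Real.two_pi_pos (fun x => (f x : ℂ)) n := by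
      rw [h, hper]
      push_cast
      field_simp
      ring
    rw [h2]
    simp [mul_pow]

lemma sum_fourier_le_integral_deriv_sq {f f' : ℝ → ℝ} (hf : ∀ x, HasDerivAt f (f' x) x)
    (hf' : Continuous f') (hper : f (2 * π) = f 0) (N : ℕ) (s : Finset ℤ)
    (hs : ∀ n : ℤ, n ∉ s → (N : ℝ) ^ 2 ≤ (n : ℝ) ^ 2) :
    ∑ n ∈ s, ((n : ℝ) ^ 2 - (N : ℝ) ^ 2) *
        ‖fourierCoeffOn Real.two_pi_pos (fun x => (f x : ℂ)) n‖ ^ 2 ≤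
      (2 * π)⁻¹ * ((∫ x in (0 : ℝ)..(2 * π), f' x ^ 2) -
        (N : ℝ) ^ 2 * ∫ x in (0 : ℝ)..(2 * π), f x ^ 2) := by
  have hcf : Continuous f := continuous_iff_continuousAt.2 fun x => (hf x).continuousAt
  have h1 := hasSum_norm_sq_fourierCoeffOn_ofReal hf'
  have h0 := (hasSum_norm_sq_fourierCoeffOn_ofReal hcf).mul_left ((N : ℝ) ^ 2)
  have h := h1.sub h0
  simp_rw [norm_sq_fourierCoeffOn_deriv hf hf' hper, ← sub_mul] at h
  have := sum_le_hasSum s (fun n hn => mul_nonneg (sub_nonneg.2 (hs n hn)) (sq_nonneg _)) h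
  refine this.trans (le_of_eq ?_)
  ring

/-- Wirtinger's inequality for periodic functions with zero mean. -/
lemma wirtinger {f f' : ℝ → ℝ} (hf : ∀ x, HasDerivAt f (f' x) x)
    (hf' : Continuous f') (hper : f (2 * π) = f 0) (hmean : ∫ x in (0 : ℝ)..(2 * π), f x = 0) :
    ∫ x in (0 : ℝ)..(2 * π), f x ^ 2 ≤ ∫ x in (0 : ℝ)..(2 * π), f' x ^ 2 := by
  have hcf : Continuous f := continuous_iff_continuousAt.2 fun x => (hf x).continuousAt
  have h := sum_fourier_le_integral_deriv_sq hf hf' hper 1 {0} (by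
    intro n hn
    have hn0 : n ≠ 0 := by simpa using hn
    have : (1 : ℤ) ≤ n ^ 2 := by have := sq_pos_of_ne_zero hn0; omega
    exact_mod_cast (by simpa using this))
  simp only [Finset.sum_singleton] at h
  rw [norm_sq_fourierCoeffOn_ofReal hcf] at h
  simp only [Int.cast_zero, zero_mul, cos_zero, sin_zero, mul_one, mul_zero, hmean,
    intervalIntegral.integral_zero] at h
  have hpi : 0 < (2 * π)⁻¹ := by positivity
  have : 0 ≤ (2 * π)⁻¹ * ((∫ x in (0 : ℝ)..(2 * π), f' x ^ 2) -
      ∫ x in (0 : ℝ)..(2 * π), f x ^ 2) := by simpa using h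
  nlinarith [nonneg_of_mul_nonneg_right this hpi]

/-- A spectral gap inequality for periodic functions with zero mean, with the low Fourier modes
accounted for explicitly. -/
lemma spectral_gap {f f' : ℝ → ℝ} (hf : ∀ x, HasDerivAt f (f' x) x)
    (hf' : Continuous f') (hper : f (2 * π) = f 0) (hmean : ∫ x in (0 : ℝ)..(2 * π), f x = 0) :
    π * (9 * ∫ x in (0 : ℝ)..(2 * π), f x ^ 2) ≤
      π * (∫ x in (0 : ℝ)..(2 * π), f' x ^ 2) +
      8 * ((∫ x in (0 : ℝ)..(2 * π), f x * cos x) ^ 2 +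
        (∫ x in (0 : ℝ)..(2 * π), f x * sin x) ^ 2) +
      5 * ((∫ x in (0 : ℝ)..(2 * π), f x * cos (2 * x)) ^ 2 +
        (∫ x in (0 : ℝ)..(2 * π), f x * sin (2 * x)) ^ 2) := by
  have hcf : Continuous f := continuous_iff_continuousAt.2 fun x => (hf x).continuousAt
  have h := sum_fourier_le_integral_deriv_sq hf hf' hper 3 {0, 1, -1, 2, -2} (by
    intro n hn
    simp only [Finset.mem_insert, Finset.mem_singleton, not_or] at hn
    have : (9 : ℤ) ≤ n ^ 2 := by
      rcases lt_or_ge n 0 with h | h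
      · nlinarith [show n ≤ -3 by omega]
      · nlinarith [show 3 ≤ n by omega]
    have h' : (9 : ℝ) ≤ (n : ℝ) ^ 2 := by exact_mod_cast this
    norm_num
    exact h')
  rw [Finset.sum_insert (by decide), Finset.sum_insert (by decide), Finset.sum_insert (by decide),
    Finset.sum_insert (by decide), Finset.sum_singleton] at h
  simp only [norm_sq_fourierCoeffOn_ofReal hcf] at h
  simp only [Int.cast_zero, Int.cast_one, Int.cast_neg, Int.cast_ofNat, zero_mul, one_mul, neg_mul,
    cos_zero, sin_zero, cos_neg, sin_neg, mul_one, mul_zero, mul_neg, hmean,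
    intervalIntegral.integral_zero, intervalIntegral.integral_neg, Nat.cast_ofNat] at h
  have hpi := Real.pi_pos
  field_simp at h
  nlinarith

lemma sq_intervalIntegral_mul_le {f g : ℝ → ℝ} (hf : Continuous f) (hg : Continuous g) {a b : ℝ}
    (hab : a ≤ b) :
    (∫ x in a..b, f x * g x) ^ 2 ≤ (∫ x in a..b, f x ^ 2) * ∫ x in a..b, g x ^ 2 := by
  have h : ∀ t : ℝ, 0 ≤ (∫ x in a..b, f x ^ 2) * (t * t) + (2 * ∫ x in a..b, f x * g x) * t +
      ∫ x in a..b, g x ^ 2 := by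
    intro t
    have h0 : 0 ≤ ∫ x in a..b, (t * f x + g x) ^ 2 :=
      intervalIntegral.integral_nonneg hab fun x _ => sq_nonneg _
    have h1 : ∫ x in a..b, (t * f x + g x) ^ 2 = (∫ x in a..b, f x ^ 2) * (t * t) +
        (2 * ∫ x in a..b, f x * g x) * t + ∫ x in a..b, g x ^ 2 := by
      have : ∀ x, (t * f x + g x) ^ 2 = (t * t) * f x ^ 2 + (2 * t) * (f x * g x) + g x ^ 2 := by
        intro x; ring
      simp_rw [this]
      rw [intervalIntegral.integral_add, intervalIntegral.integral_add,
        intervalIntegral.integral_const_mul, intervalIntegral.integral_const_mul]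
      · ring
      all_goals exact Continuous.intervalIntegrable (by fun_prop) _ _
    rwa [h1] at h0
  have := discrim_le_zero h
  rw [discrim] at this
  nlinarith

/-- A periodic function with zero mean is controlled pointwise by the `L²` norm of its
derivative. -/
lemma sq_le_of_integral_eq_zero {f f' : ℝ → ℝ} (hf : ∀ x, HasDerivAt f (f' x) x)
    (hf' : Continuous f') (hmean : ∫ x in (0 : ℝ)..(2 * π), f x = 0) {x : ℝ}
    (hx : x ∈ Set.Icc 0 (2 * π)) :
    f x ^ 2 ≤ 2 * π * ∫ x in (0 : ℝ)..(2 * π), f' x ^ 2 := by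
  have hcf : Continuous f := continuous_iff_continuousAt.2 fun x => (hf x).continuousAt
  have hF : ∀ y, HasDerivAt (fun y => ∫ x in (0 : ℝ)..y, f x) (f y) y := fun y =>
    intervalIntegral.integral_hasDerivAt_right (hcf.intervalIntegrable _ _)
      (hcf.stronglyMeasurableAtFilter _ _) hcf.continuousAt
  obtain ⟨z, hz, hfz⟩ := exists_hasDerivAt_eq_zero Real.two_pi_pos
    (fun y _ => (hF y).continuousAt.continuousWithinAt) (by simp [hmean]) (fun y _ => hF y)
  have key : ∀ a b : ℝ, 0 ≤ a → a ≤ b → b ≤ 2 * π → (f b - f a) ^ 2 ≤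
      2 * π * ∫ x in (0 : ℝ)..(2 * π), f' x ^ 2 := by
    intro a b ha hab hb
    have h1 := sq_intervalIntegral_mul_le (f := fun _ => 1) continuous_const hf' hab
    simp only [one_mul, one_pow, intervalIntegral.integral_const, smul_eq_mul, mul_one] at h1
    rw [intervalIntegral.integral_eq_sub_of_hasDerivAt (fun x _ => hf x)
      (hf'.intervalIntegrable _ _)] at h1
    have h2 : ∫ x in a..b, f' x ^ 2 ≤ ∫ x in (0 : ℝ)..(2 * π), f' x ^ 2 :=
      intervalIntegral.integral_mono_interval ha hab hb
        (Filter.Eventually.of_forall fun x => sq_nonneg _)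
        (Continuous.intervalIntegrable (by fun_prop) _ _)
    have h3 : 0 ≤ ∫ x in a..b, f' x ^ 2 :=
      intervalIntegral.integral_nonneg hab fun x _ => sq_nonneg _
    calc _ ≤ _ := h1
      _ ≤ 2 * π * ∫ x in (0 : ℝ)..(2 * π), f' x ^ 2 :=
        mul_le_mul (by linarith) h2 h3 Real.two_pi_pos.le
  rcases le_total z x with h | h
  · simpa [hfz] using key z x hz.1.le h hx.2
  · simpa [hfz] using key x z hx.1 h hz.2.le

/-- A solution of Hill's equation `y'' + q y = 0` with `q` close to one and unit initial data
is bounded on a period. -/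
lemma hill_energy_le {q y z : ℝ → ℝ} (hy : ∀ x, HasDerivAt y (z x) x)
    (hz : ∀ x, HasDerivAt z (-(q x * y x)) x) {δ : ℝ} (hδ : δ ≤ 1 / 8)
    (hq : ∀ x ∈ Set.Icc 0 (2 * π), |q x - 1| ≤ δ) (h0 : y 0 ^ 2 + z 0 ^ 2 = 1) {x : ℝ}
    (hx : x ∈ Set.Icc 0 (2 * π)) : y x ^ 2 + z x ^ 2 ≤ 4 := by
  have hd : ∀ s, HasDerivAt (fun s => (y s ^ 2 + z s ^ 2) * exp (-δ * s))
      ((2 * z s * (1 - q s) * y s - δ * (y s ^ 2 + z s ^ 2)) * exp (-δ * s)) s := by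
    intro s
    have he : HasDerivAt (fun s => exp (-δ * s)) (exp (-δ * s) * (-δ * 1)) s :=
      ((hasDerivAt_id s).const_mul (-δ)).exp
    refine ((((hy s).fun_pow 2).fun_add ((hz s).fun_pow 2)).fun_mul he).congr_deriv ?_
    simp
    ring
  have hanti : AntitoneOn (fun s => (y s ^ 2 + z s ^ 2) * exp (-δ * s)) (Set.Icc 0 (2 * π)) := by
    refine antitoneOn_of_hasDerivWithinAt_nonpos (convex_Icc _ _)
      (fun s _ => (hd s).continuousAt.continuousWithinAt)
      (fun s _ => (hd s).hasDerivWithinAt) fun s hs => ?_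
    rw [interior_Icc] at hs
    have h1 := abs_le.1 (hq s ⟨hs.1.le, hs.2.le⟩)
    refine mul_nonpos_of_nonpos_of_nonneg ?_ (exp_pos _).le
    nlinarith [mul_nonneg (sub_nonneg.2 h1.2) (sq_nonneg (y s + z s)),
      mul_nonneg (by linarith [h1.1] : 0 ≤ δ + (q s - 1)) (sq_nonneg (y s - z s)),
      mul_nonneg (sub_nonneg.2 h1.2) (sq_nonneg (y s - z s)),
      mul_nonneg (by linarith [h1.1] : 0 ≤ δ + (q s - 1)) (sq_nonneg (y s + z s))]
  have h := hanti ⟨le_rfl, Real.two_pi_pos.le⟩ hx hx.1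
  simp only [mul_zero, exp_zero, mul_one, h0] at h
  have hδ0 : 0 ≤ δ := (abs_nonneg _).trans (hq x hx)
  have h4 : exp (δ * x) ≤ 4 := by
    have : δ * x ≤ 1 := by nlinarith [hx.1, hx.2, Real.pi_lt_four]
    exact (exp_le_exp.2 this).trans (by linarith [Real.exp_one_lt_d9])
  have h5 : exp (-δ * x) * exp (δ * x) = 1 := by rw [← exp_add]; simp
  calc y x ^ 2 + z x ^ 2 = (y x ^ 2 + z x ^ 2) * exp (-δ * x) * exp (δ * x) := by
        rw [mul_assoc, h5, mul_one]
    _ ≤ 1 * exp (δ * x) := mul_le_mul_of_nonneg_right h (exp_pos _).le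
    _ ≤ 4 := by linarith

/-- Comparison of Hill's equation `y'' + q y = 0`, for `q` close to one, with `y'' + y = 0`. -/
lemma hill_abs_sub_le {q y z : ℝ → ℝ} (hy : ∀ x, HasDerivAt y (z x) x)
    (hz : ∀ x, HasDerivAt z (-(q x * y x)) x) {δ : ℝ} (hδ : δ ≤ 1 / 8)
    (hq : ∀ x ∈ Set.Icc 0 (2 * π), |q x - 1| ≤ δ) (h0 : y 0 ^ 2 + z 0 ^ 2 = 1) {x : ℝ}
    (hx : x ∈ Set.Icc 0 (2 * π)) : |y x - (y 0 * cos x + z 0 * sin x)| ≤ 32 * δ := by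
  have hδ0 : 0 ≤ δ := (abs_nonneg _).trans (hq x hx)
  have hA : ∀ s, HasDerivAt (fun s => y s * cos s - z s * sin s) ((q s - 1) * y s * sin s) s := by
    intro s
    refine (((hy s).fun_mul (hasDerivAt_cos s)).fun_sub ((hz s).fun_mul (hasDerivAt_sin s))).congr_deriv ?_
    ring
  have hB : ∀ s, HasDerivAt (fun s => y s * sin s + z s * cos s) (-((q s - 1) * y s * cos s)) s := by
    intro s
    refine (((hy s).fun_mul (hasDerivAt_sin s)).fun_add ((hz s).fun_mul (hasDerivAt_cos s))).congr_deriv ?_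
    ring
  have hbound : ∀ s ∈ Set.Icc 0 (2 * π), |(q s - 1) * y s| ≤ 2 * δ := by
    intro s hs
    have h1 := hill_energy_le hy hz hδ hq h0 hs
    have h2 : |y s| ≤ 2 := abs_le_of_sq_le_sq (by nlinarith [sq_nonneg (z s)]) (by norm_num)
    rw [abs_mul]
    nlinarith [mul_le_mul (hq s hs) h2 (abs_nonneg _) hδ0]
  have hAb := (convex_Icc 0 (2 * π)).norm_image_sub_le_of_norm_hasDerivWithin_le (C := 2 * δ)
    (fun s _ => (hA s).hasDerivWithinAt) (fun s hs => by
      rw [Real.norm_eq_abs, abs_mul]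
      exact (mul_le_of_le_one_right (abs_nonneg _) (abs_sin_le_one s)).trans (hbound s hs))
    (⟨le_rfl, Real.two_pi_pos.le⟩ : (0 : ℝ) ∈ Set.Icc 0 (2 * π)) hx
  have hBb := (convex_Icc 0 (2 * π)).norm_image_sub_le_of_norm_hasDerivWithin_le (C := 2 * δ)
    (fun s _ => (hB s).hasDerivWithinAt) (fun s hs => by
      rw [Real.norm_eq_abs, abs_neg, abs_mul]
      exact (mul_le_of_le_one_right (abs_nonneg _) (abs_cos_le_one s)).trans (hbound s hs))
    (⟨le_rfl, Real.two_pi_pos.le⟩ : (0 : ℝ) ∈ Set.Icc 0 (2 * π)) hx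
  simp only [Real.norm_eq_abs, cos_zero, sin_zero, mul_one, mul_zero, sub_zero, zero_add,
    abs_of_nonneg hx.1] at hAb hBb
  have hx8 : 2 * δ * x ≤ 16 * δ := by nlinarith [hx.1, hx.2, Real.pi_lt_four]
  have hid : y x - (y 0 * cos x + z 0 * sin x) =
      (y x * cos x - z x * sin x - y 0) * cos x + (y x * sin x + z x * cos x - z 0) * sin x := by
    linear_combination -(y x) * (Real.sin_sq_add_cos_sq x)
  rw [hid]
  refine (abs_add_le _ _).trans ?_
  rw [abs_mul, abs_mul]
  have h1 := mul_le_of_le_one_right (abs_nonneg (y x * cos x - z x * sin x - y 0)) (abs_cos_le_one x)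
  have h2 := mul_le_of_le_one_right (abs_nonneg (y x * sin x + z x * cos x - z 0)) (abs_sin_le_one x)
  linarith

lemma sq_integral_mul_le_of_orthogonal {f g h : ℝ → ℝ} (hf : Continuous f) (hg : Continuous g)
    (hh : Continuous h) {m : ℝ} (hm : ∀ x ∈ Set.Icc 0 (2 * π), |g x - h x| ≤ m)
    (horth : ∫ x in (0 : ℝ)..(2 * π), f x * g x = 0) :
    (∫ x in (0 : ℝ)..(2 * π), f x * h x) ^ 2 ≤
      2 * π * m ^ 2 * ∫ x in (0 : ℝ)..(2 * π), f x ^ 2 := by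
  have h1 : ∫ x in (0 : ℝ)..(2 * π), f x * (g x - h x) = -∫ x in (0 : ℝ)..(2 * π), f x * h x := by
    simp_rw [mul_sub]
    rw [intervalIntegral.integral_sub, horth, zero_sub]
    all_goals exact Continuous.intervalIntegrable (by fun_prop) _ _
  have h2 := sq_intervalIntegral_mul_le hf (hg.sub hh) Real.two_pi_pos.le
  simp only [Pi.sub_apply] at h2
  rw [h1, neg_sq] at h2
  have h3 : ∫ x in (0 : ℝ)..(2 * π), (g x - h x) ^ 2 ≤ ∫ x in (0 : ℝ)..(2 * π), m ^ 2 :=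
    intervalIntegral.integral_mono_on Real.two_pi_pos.le
      (Continuous.intervalIntegrable (by fun_prop) _ _)
      (Continuous.intervalIntegrable (by fun_prop) _ _)
      fun x hx => sq_le_sq' (abs_le.1 (hm x hx)).1 (abs_le.1 (hm x hx)).2
  rw [intervalIntegral.integral_const, smul_eq_mul, sub_zero] at h3
  have h4 : 0 ≤ ∫ x in (0 : ℝ)..(2 * π), f x ^ 2 :=
    intervalIntegral.integral_nonneg Real.two_pi_pos.le fun x _ => sq_nonneg _
  nlinarith [mul_le_mul_of_nonneg_left h3 h4]

lemma integral_deriv_mul_eq_zero {f f' g g' : ℝ → ℝ} (hf : ∀ x, HasDerivAt f (f' x) x)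
    (hf' : Continuous f') (hg : ∀ x, HasDerivAt g (g' x) x) (hg' : Continuous g')
    (hper : f (2 * π) * g (2 * π) = f 0 * g 0) :
    ∫ x in (0 : ℝ)..(2 * π), f' x * g x = -∫ x in (0 : ℝ)..(2 * π), f x * g' x := by
  have hcf : Continuous f := continuous_iff_continuousAt.2 fun x => (hf x).continuousAt
  have hcg : Continuous g := continuous_iff_continuousAt.2 fun x => (hg x).continuousAt
  rw [eq_neg_iff_add_eq_zero, ← intervalIntegral.integral_add,
    intervalIntegral.integral_eq_sub_of_hasDerivAt (fun x _ => (hf x).fun_mul (hg x)), hper,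
    sub_self]
  all_goals exact Continuous.intervalIntegrable (by fun_prop) _ _

/-- A Hill equation `y'' + q y = 0` on the circle of length `2π` all of whose solutions are periodic
and have zero mean. -/
structure BalancedHill (q q' y₁ z₁ y₂ z₂ : ℝ → ℝ) : Prop where
  deriv_q : ∀ x, HasDerivAt q (q' x) x
  cont_q' : Continuous q'
  per_q : q (2 * π) = q 0
  deriv_y₁ : ∀ x, HasDerivAt y₁ (z₁ x) x
  deriv_z₁ : ∀ x, HasDerivAt z₁ (-(q x * y₁ x)) x
  deriv_y₂ : ∀ x, HasDerivAt y₂ (z₂ x) x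
  deriv_z₂ : ∀ x, HasDerivAt z₂ (-(q x * y₂ x)) x
  init_y₁ : y₁ 0 = 1
  init_z₁ : z₁ 0 = 0
  init_y₂ : y₂ 0 = 0
  init_z₂ : z₂ 0 = 1
  per_y₁ : y₁ (2 * π) = y₁ 0
  per_z₁ : z₁ (2 * π) = z₁ 0
  per_y₂ : y₂ (2 * π) = y₂ 0
  per_z₂ : z₂ (2 * π) = z₂ 0
  mean_y₁ : ∫ x in (0 : ℝ)..(2 * π), y₁ x = 0
  mean_y₂ : ∫ x in (0 : ℝ)..(2 * π), y₂ x = 0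

lemma hill_mean_ge {q y z : ℝ → ℝ} (hq : Continuous q) (hy : ∀ x, HasDerivAt y (z x) x)
    (hz : ∀ x, HasDerivAt z (-(q x * y x)) x) (hpy : y (2 * π) = y 0) (hpz : z (2 * π) = z 0)
    (hmean : ∫ x in (0 : ℝ)..(2 * π), y x = 0) (hy0 : y 0 ≠ 0) {b : ℝ}
    (hb : ∀ x ∈ Set.Icc 0 (2 * π), q x ≤ b) : 1 ≤ b := by
  have hcy : Continuous y := continuous_iff_continuousAt.2 fun x => (hy x).continuousAt
  have hcz : Continuous z := continuous_iff_continuousAt.2 fun x => (hz x).continuousAt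
  have h1 := wirtinger hy hcz hpy hmean
  have h2 := integral_deriv_mul_eq_zero hy hcz hz (by fun_prop) (by rw [hpy, hpz])
  have h3 : ∫ x in (0 : ℝ)..(2 * π), z x ^ 2 = ∫ x in (0 : ℝ)..(2 * π), q x * y x ^ 2 := by
    simp_rw [pow_two]
    rw [h2, ← intervalIntegral.integral_neg]
    congr 1
    ext x
    ring
  have h4 : ∫ x in (0 : ℝ)..(2 * π), q x * y x ^ 2 ≤ ∫ x in (0 : ℝ)..(2 * π), b * y x ^ 2 :=
    intervalIntegral.integral_mono_on Real.two_pi_pos.le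
      (Continuous.intervalIntegrable (by fun_prop) _ _)
      (Continuous.intervalIntegrable (by fun_prop) _ _)
      fun x hx => mul_le_mul_of_nonneg_right (hb x hx) (sq_nonneg _)
  rw [intervalIntegral.integral_const_mul] at h4
  have h5 : 0 < ∫ x in (0 : ℝ)..(2 * π), y x ^ 2 :=
    intervalIntegral.integral_pos Real.two_pi_pos (by fun_prop) (fun x _ => sq_nonneg _)
      ⟨0, ⟨le_rfl, Real.two_pi_pos.le⟩, by positivity⟩
  nlinarith

namespace BalancedHill

variable {q q' y₁ z₁ y₂ z₂ : ℝ → ℝ}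

lemma integral_deriv_mul_solutions {y z w v : ℝ → ℝ} (hq : ∀ x, HasDerivAt q (q' x) x)
    (hq' : Continuous q') (hpq : q (2 * π) = q 0)
    (hy : ∀ x, HasDerivAt y (z x) x) (hz : ∀ x, HasDerivAt z (-(q x * y x)) x)
    (hw : ∀ x, HasDerivAt w (v x) x) (hv : ∀ x, HasDerivAt v (-(q x * w x)) x)
    (hpy : y (2 * π) = y 0) (hpz : z (2 * π) = z 0) (hpw : w (2 * π) = w 0)
    (hpv : v (2 * π) = v 0) :
    ∫ x in (0 : ℝ)..(2 * π), q' x * (y x * w x) = 0 := by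
  have hcy : Continuous y := continuous_iff_continuousAt.2 fun x => (hy x).continuousAt
  have hcw : Continuous w := continuous_iff_continuousAt.2 fun x => (hw x).continuousAt
  have hd : ∀ x, HasDerivAt (fun x => q x * (y x * w x) + z x * v x) (q' x * (y x * w x)) x := by
    intro x
    refine (((hq x).fun_mul ((hy x).fun_mul (hw x))).fun_add ((hz x).fun_mul (hv x))).congr_deriv ?_
    ring
  rw [intervalIntegral.integral_eq_sub_of_hasDerivAt (fun x _ => hd x)
    (Continuous.intervalIntegrable (by fun_prop) _ _)]
  simp only [hpq, hpy, hpz, hpw, hpv, sub_self]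

lemma integral_sub_mul_solution {y z : ℝ → ℝ} (hq : Continuous q) (c : ℝ)
    (hy : ∀ x, HasDerivAt y (z x) x) (hz : ∀ x, HasDerivAt z (-(q x * y x)) x)
    (hpz : z (2 * π) = z 0) (hmean : ∫ x in (0 : ℝ)..(2 * π), y x = 0) :
    ∫ x in (0 : ℝ)..(2 * π), (q x - c) * y x = 0 := by
  have hcy : Continuous y := continuous_iff_continuousAt.2 fun x => (hy x).continuousAt
  have h1 : ∫ x in (0 : ℝ)..(2 * π), -(q x * y x) = 0 := by
    rw [intervalIntegral.integral_eq_sub_of_hasDerivAt (fun x _ => hz x)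
      (Continuous.intervalIntegrable (by fun_prop) _ _), hpz, sub_self]
  rw [intervalIntegral.integral_neg, neg_eq_zero] at h1
  simp_rw [sub_mul]
  rw [intervalIntegral.integral_sub, intervalIntegral.integral_const_mul, h1, hmean]
  · simp
  all_goals exact Continuous.intervalIntegrable (by fun_prop) _ _

lemma gap (H : BalancedHill q q' y₁ z₁ y₂ z₂) {c : ℝ} (hc : c ≤ 1)
    (hmean : ∫ x in (0 : ℝ)..(2 * π), (q x - c) = 0)
    (hsmall : ∫ x in (0 : ℝ)..(2 * π), (q x - c) ^ 2 ≤ 1 / 10 ^ 9) :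
    8 * ∫ x in (0 : ℝ)..(2 * π), (q x - c) ^ 2 ≤ ∫ x in (0 : ℝ)..(2 * π), q' x ^ 2 := by
  by_contra! hlt
  have hcq' := H.cont_q'
  have hcq : Continuous q := continuous_iff_continuousAt.2 fun x => (H.deriv_q x).continuousAt
  have hcy₁ : Continuous y₁ := continuous_iff_continuousAt.2 fun x => (H.deriv_y₁ x).continuousAt
  have hcy₂ : Continuous y₂ := continuous_iff_continuousAt.2 fun x => (H.deriv_y₂ x).continuousAt
  have hW : ∀ x, HasDerivAt (fun x => q x - c) (q' x) x := fun x => (H.deriv_q x).sub_const c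
  have hpW : q (2 * π) - c = q 0 - c := by rw [H.per_q]
  have hpi := Real.pi_pos
  have hpi4 := Real.pi_lt_four
  have hD0 : 0 ≤ ∫ x in (0 : ℝ)..(2 * π), q' x ^ 2 :=
    intervalIntegral.integral_nonneg Real.two_pi_pos.le fun x _ => sq_nonneg _
  have hsup : ∀ x ∈ Set.Icc 0 (2 * π), |q x - c| ≤ 1 / 2560 := by
    intro x hx
    have := sq_le_of_integral_eq_zero hW hcq' hmean hx
    refine abs_le_of_sq_le_sq (this.trans ?_) (by norm_num)
    nlinarith
  have hc1 : 1 ≤ c + 1 / 2560 :=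
    hill_mean_ge hcq H.deriv_y₁ H.deriv_z₁ H.per_y₁ H.per_z₁ H.mean_y₁
      (by rw [H.init_y₁]; exact one_ne_zero) fun x hx => by
        linarith [(abs_le.1 (hsup x hx)).2]
  have hq1 : ∀ x ∈ Set.Icc 0 (2 * π), |q x - 1| ≤ 1 / 1280 := by
    intro x hx
    have := abs_le.1 (hsup x hx)
    exact abs_le.2 ⟨by linarith, by linarith⟩
  have hy₁ : ∀ x ∈ Set.Icc 0 (2 * π), |y₁ x - cos x| ≤ 1 / 40 := by
    intro x hx
    have := hill_abs_sub_le H.deriv_y₁ H.deriv_z₁ (by norm_num) hq1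
      (by rw [H.init_y₁, H.init_z₁]; norm_num) hx
    rw [H.init_y₁, H.init_z₁, one_mul, zero_mul, add_zero] at this
    linarith
  have hy₂ : ∀ x ∈ Set.Icc 0 (2 * π), |y₂ x - sin x| ≤ 1 / 40 := by
    intro x hx
    have := hill_abs_sub_le H.deriv_y₂ H.deriv_z₂ (by norm_num) hq1
      (by rw [H.init_y₂, H.init_z₂]; norm_num) hx
    rw [H.init_y₂, H.init_z₂, one_mul, zero_mul, zero_add] at this
    linarith
  have hcos2 : ∀ x ∈ Set.Icc 0 (2 * π), |(y₁ x * y₁ x - y₂ x * y₂ x) - cos (2 * x)| ≤ 3 / 20 := by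
    intro x hx
    have h1 := abs_le.1 (hy₁ x hx)
    have h2 := abs_le.1 (hy₂ x hx)
    have h3 := abs_le.1 (abs_cos_le_one x)
    have h4 := abs_le.1 (abs_sin_le_one x)
    rw [Real.cos_two_mul']
    exact abs_le.2 ⟨by nlinarith, by nlinarith⟩
  have hsin2 : ∀ x ∈ Set.Icc 0 (2 * π), |2 * (y₁ x * y₂ x) - sin (2 * x)| ≤ 3 / 20 := by
    intro x hx
    have h1 := abs_le.1 (hy₁ x hx)
    have h2 := abs_le.1 (hy₂ x hx)
    have h3 := abs_le.1 (abs_cos_le_one x)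
    have h4 := abs_le.1 (abs_sin_le_one x)
    rw [Real.sin_two_mul]
    exact abs_le.2 ⟨by nlinarith, by nlinarith⟩
  have ha₁ := sq_integral_mul_le_of_orthogonal (f := fun x => q x - c) (by fun_prop) hcy₁
    continuous_cos hy₁
    (integral_sub_mul_solution hcq c H.deriv_y₁ H.deriv_z₁ H.per_z₁ H.mean_y₁)
  have hb₁ := sq_integral_mul_le_of_orthogonal (f := fun x => q x - c) (by fun_prop) hcy₂
    continuous_sin hy₂
    (integral_sub_mul_solution hcq c H.deriv_y₂ H.deriv_z₂ H.per_z₂ H.mean_y₂)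
  have h11 := integral_deriv_mul_solutions H.deriv_q hcq' H.per_q H.deriv_y₁ H.deriv_z₁ H.deriv_y₁
    H.deriv_z₁ H.per_y₁ H.per_z₁ H.per_y₁ H.per_z₁
  have h12 := integral_deriv_mul_solutions H.deriv_q hcq' H.per_q H.deriv_y₁ H.deriv_z₁ H.deriv_y₂
    H.deriv_z₂ H.per_y₁ H.per_z₁ H.per_y₂ H.per_z₂
  have h22 := integral_deriv_mul_solutions H.deriv_q hcq' H.per_q H.deriv_y₂ H.deriv_z₂ H.deriv_y₂
    H.deriv_z₂ H.per_y₂ H.per_z₂ H.per_y₂ H.per_z₂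
  have hC := sq_integral_mul_le_of_orthogonal (h := fun x => cos (2 * x)) hcq' (by fun_prop)
    (by fun_prop) hcos2 (by
      simp_rw [mul_sub]
      rw [intervalIntegral.integral_sub, h11, h22, sub_zero]
      all_goals exact Continuous.intervalIntegrable (by fun_prop) _ _)
  have hS := sq_integral_mul_le_of_orthogonal (h := fun x => sin (2 * x)) hcq' (by fun_prop)
    (by fun_prop) hsin2 (by
      simp_rw [mul_left_comm _ (2 : ℝ)]
      rw [intervalIntegral.integral_const_mul, h12, mul_zero])
  have hdc : ∀ x, HasDerivAt (fun x => cos (2 * x)) (-2 * sin (2 * x)) x := by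
    intro x
    refine (((hasDerivAt_id x).const_mul 2).cos).congr_deriv ?_
    simp
    ring
  have hds : ∀ x, HasDerivAt (fun x => sin (2 * x)) (2 * cos (2 * x)) x := by
    intro x
    refine (((hasDerivAt_id x).const_mul 2).sin).congr_deriv ?_
    simp
    ring
  have h4pi : (2 : ℝ) * (2 * π) = (2 : ℕ) * (2 * π) := by norm_num
  have hC2 := integral_deriv_mul_eq_zero hW hcq' hdc (by fun_prop) (by
    rw [hpW, h4pi, Real.cos_nat_mul_two_pi]; simp)
  have hS2 := integral_deriv_mul_eq_zero hW hcq' hds (by fun_prop) (by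
    rw [hpW, h4pi, ← zero_add ((2 : ℕ) * (2 * π)), Real.sin_add_nat_mul_two_pi]; simp)
  simp_rw [mul_left_comm _ (-2 : ℝ)] at hC2
  simp_rw [mul_left_comm _ (2 : ℝ)] at hS2
  rw [intervalIntegral.integral_const_mul] at hC2 hS2
  rw [hC2] at hC
  rw [hS2] at hS
  have hgap := spectral_gap hW hcq' hpW hmean
  nlinarith

lemma dissipation_le (H : BalancedHill q q' y₁ z₁ y₂ z₂) {c : ℝ} (hc : c ≤ 1)
    (hmean : ∫ x in (0 : ℝ)..(2 * π), (q x - c) = 0)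
    (hsmall : ∫ x in (0 : ℝ)..(2 * π), (q x - c) ^ 2 ≤ 1 / 10 ^ 9) :
    3 / 2 * (∫ x in (0 : ℝ)..(2 * π), (q x - c) ^ 3) +
      2 * c * (∫ x in (0 : ℝ)..(2 * π), (q x - c) ^ 2) -
      1 / 2 * ∫ x in (0 : ℝ)..(2 * π), q' x ^ 2 ≤ -∫ x in (0 : ℝ)..(2 * π), (q x - c) ^ 2 := by
  have hgap := H.gap hc hmean hsmall
  have hcq : Continuous q := continuous_iff_continuousAt.2 fun x => (H.deriv_q x).continuousAt
  have hW : ∀ x, HasDerivAt (fun x => q x - c) (q' x) x := fun x => (H.deriv_q x).sub_const c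
  set D := ∫ x in (0 : ℝ)..(2 * π), q' x ^ 2
  set E := ∫ x in (0 : ℝ)..(2 * π), (q x - c) ^ 2
  have hE0 : 0 ≤ E := intervalIntegral.integral_nonneg Real.two_pi_pos.le fun x _ => sq_nonneg _
  have hcube : ∫ x in (0 : ℝ)..(2 * π), (q x - c) ^ 3 ≤
      ∫ x in (0 : ℝ)..(2 * π), √(2 * π * D) * (q x - c) ^ 2 := by
    refine intervalIntegral.integral_mono_on Real.two_pi_pos.le
      (Continuous.intervalIntegrable (by fun_prop) _ _)
      (Continuous.intervalIntegrable (by fun_prop) _ _) fun x hx => ?_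
    have h := Real.le_sqrt_of_sq_le (sq_le_of_integral_eq_zero hW H.cont_q' hmean hx)
    calc (q x - c) ^ 3 = (q x - c) * (q x - c) ^ 2 := by ring
      _ ≤ _ := mul_le_mul_of_nonneg_right h (sq_nonneg _)
  rw [intervalIntegral.integral_const_mul] at hcube
  have hsq : √(2 * π * D) ^ 2 = 2 * π * D :=
    Real.sq_sqrt (mul_nonneg Real.two_pi_pos.le (by linarith))
  have hpi4 := Real.pi_lt_four
  have hDpi : 2 * π * D ≤ 8 * D := by nlinarith
  have hcE : c * E ≤ E := mul_le_of_le_one_left hE0 hc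
  have hEE : E ^ 2 ≤ E / 10 ^ 9 := by nlinarith
  have hyoung : √(2 * π * D) * E ≤ 1 / 200 * √(2 * π * D) ^ 2 + 50 * E ^ 2 := by
    nlinarith [sq_nonneg (√(2 * π * D) - 100 * E)]
  linarith

end BalancedHill

/-- Reparametrization of a circle of total mass `2π` by arc length. -/
lemma exists_arclength_param {ρ : ℝ → ℝ} (hρ : Continuous ρ) (hpos : ∀ x, 0 < ρ x)
    (hper : ∀ x, ρ (x + 2 * π) = ρ x) (hmass : ∫ x in (0 : ℝ)..(2 * π), ρ x = 2 * π) :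
    ∃ τ : ℝ → ℝ, (∀ s, HasDerivAt τ (ρ (τ s))⁻¹ s) ∧ τ 0 = 0 ∧ τ (2 * π) = 2 * π ∧
      ∀ G : ℝ → ℝ, Continuous G →
        ∫ s in (0 : ℝ)..(2 * π), G (τ s) = ∫ x in (0 : ℝ)..(2 * π), G x * ρ x := by
  set σ : ℝ → ℝ := fun y => ∫ x in (0 : ℝ)..y, ρ x with hσdef
  have hσ : ∀ y, HasDerivAt σ (ρ y) y := fun y =>
    intervalIntegral.integral_hasDerivAt_right (hρ.intervalIntegrable _ _)
      (hρ.stronglyMeasurableAtFilter _ _) hρ.continuousAt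
  have hcσ : Continuous σ := continuous_iff_continuousAt.2 fun x => (hσ x).continuousAt
  have hmono : StrictMono σ := strictMono_of_deriv_pos fun x => by
    rw [(hσ x).deriv]; exact hpos x
  have hfp : Function.Periodic ρ (2 * π) := hper
  have hint : ∀ a b, IntervalIntegrable ρ volume a b := fun a b => hρ.intervalIntegrable a b
  have hm : 0 < ∫ x in (0 : ℝ)..(2 * π), ρ x := by rw [hmass]; exact Real.two_pi_pos
  have hsurj : Function.Surjective σ := hcσ.surjective
    (hfp.tendsto_atTop_intervalIntegral_of_pos hm Real.two_pi_pos)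
    (hfp.tendsto_atBot_intervalIntegral_of_pos hm Real.two_pi_pos)
  set e := hmono.orderIsoOfSurjective σ hsurj
  have heσ : ∀ s, σ (e.symm s) = s := fun s => e.apply_symm_apply s
  have hτ0 : e.symm 0 = 0 := hmono.injective (by rw [heσ]; simp [hσdef])
  have hτ1 : e.symm (2 * π) = 2 * π := hmono.injective (by rw [heσ]; simp [hσdef, hmass])
  have hτ : ∀ s, HasDerivAt e.symm (ρ (e.symm s))⁻¹ s := fun s =>
    HasDerivAt.of_local_left_inverse e.symm.continuous.continuousAt (hσ _) (hpos _).ne'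
      (Filter.Eventually.of_forall heσ)
  refine ⟨e.symm, hτ, hτ0, hτ1, fun G hG => ?_⟩
  have hsub := intervalIntegral.integral_comp_mul_deriv (a := 0) (b := 2 * π)
    (g := fun x => G x * ρ x) (fun s _ => hτ s)
    (Continuous.continuousOn (by
      have := e.symm.continuous
      exact Continuous.inv₀ (by fun_prop) fun s => (hpos _).ne')) (by fun_prop)
  rw [hτ0, hτ1] at hsub
  rw [← hsub]
  refine intervalIntegral.integral_congr fun s _ => ?_
  have := (hpos (e.symm s)).ne'
  simp only [Function.comp_apply]
  field_simp

/-- The data of a positive `2π`-periodic function `v` on the circle, together with its first two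
derivatives, the affine curvature `k = v³ (v'' + v)` and its derivative. -/
structure AffineMetric (v v₁ v₂ k k₁ : ℝ → ℝ) : Prop where
  pos : ∀ x, 0 < v x
  per_v : ∀ x, v (x + 2 * π) = v x
  per_v₁ : ∀ x, v₁ (x + 2 * π) = v₁ x
  per_k : ∀ x, k (x + 2 * π) = k x
  deriv_v : ∀ x, HasDerivAt v (v₁ x) x
  deriv_v₁ : ∀ x, HasDerivAt v₁ (v₂ x) x
  deriv_k : ∀ x, HasDerivAt k (k₁ x) x
  cont_v₂ : Continuous v₂
  cont_k₁ : Continuous k₁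
  k_eq : ∀ x, k x = v x ^ 3 * (v₂ x + v x)
  mass : ∫ x in (0 : ℝ)..(2 * π), (v x ^ 2)⁻¹ = 2 * π

namespace AffineMetric

variable {v v₁ v₂ k k₁ : ℝ → ℝ}

lemma cont_v (H : AffineMetric v v₁ v₂ k k₁) : Continuous v :=
  continuous_iff_continuousAt.2 fun x => (H.deriv_v x).continuousAt

lemma cont_v₁ (H : AffineMetric v v₁ v₂ k k₁) : Continuous v₁ :=
  continuous_iff_continuousAt.2 fun x => (H.deriv_v₁ x).continuousAt

lemma cont_k (H : AffineMetric v v₁ v₂ k k₁) : Continuous k :=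
  continuous_iff_continuousAt.2 fun x => (H.deriv_k x).continuousAt

lemma cont_density (H : AffineMetric v v₁ v₂ k k₁) : Continuous fun x => (v x ^ 2)⁻¹ :=
  (H.cont_v.pow 2).inv₀ fun x => (pow_pos (H.pos x) 2).ne'

lemma integral_dissipation_le (H : AffineMetric v v₁ v₂ k k₁)
    (hcos : ∫ x in (0 : ℝ)..(2 * π), (v x ^ 3)⁻¹ * cos x = 0)
    (hsin : ∫ x in (0 : ℝ)..(2 * π), (v x ^ 3)⁻¹ * sin x = 0) {c : ℝ} (hc : c ≤ 1)
    (hmean : ∫ x in (0 : ℝ)..(2 * π), (k x - c) * (v x ^ 2)⁻¹ = 0)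
    (hsmall : ∫ x in (0 : ℝ)..(2 * π), (k x - c) ^ 2 * (v x ^ 2)⁻¹ ≤ 1 / 10 ^ 9) :
    3 / 2 * (∫ x in (0 : ℝ)..(2 * π), (k x - c) ^ 3 * (v x ^ 2)⁻¹) +
      2 * c * (∫ x in (0 : ℝ)..(2 * π), (k x - c) ^ 2 * (v x ^ 2)⁻¹) -
      1 / 2 * (∫ x in (0 : ℝ)..(2 * π), k₁ x ^ 2 * v x ^ 2) ≤
      -∫ x in (0 : ℝ)..(2 * π), (k x - c) ^ 2 * (v x ^ 2)⁻¹ := by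
  have hv0 : ∀ x, v x ≠ 0 := fun x => (H.pos x).ne'
  have hcv := H.cont_v
  have hcv₁ := H.cont_v₁
  have hck := H.cont_k
  have hck₁ := H.cont_k₁
  obtain ⟨τ, hτ, hτ0, hτ1, hint⟩ := exists_arclength_param H.cont_density
    (fun x => inv_pos.2 (pow_pos (H.pos x) 2)) (fun x => by rw [H.per_v]) H.mass
  simp only [inv_inv] at hτ
  have hcτ : Continuous τ := continuous_iff_continuousAt.2 fun x => (hτ x).continuousAt
  have hX : ∀ α β x : ℝ, HasDerivAt (fun x => (α * cos x + β * sin x) / v x)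
      ((v x * (-α * sin x + β * cos x) - v₁ x * (α * cos x + β * sin x)) / v x ^ 2) x := by
    intro α β x
    refine ((((hasDerivAt_cos x).const_mul α).fun_add ((hasDerivAt_sin x).const_mul β)).fun_div
      (H.deriv_v x) (hv0 x)).congr_deriv ?_
    ring
  have hZ : ∀ α β x : ℝ, HasDerivAt
      (fun x => v x * (-α * sin x + β * cos x) - v₁ x * (α * cos x + β * sin x))
      (-((v₂ x + v x) * (α * cos x + β * sin x))) x := by
    intro α β x
    refine (((H.deriv_v x).fun_mul (((hasDerivAt_sin x).const_mul (-α)).fun_add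
      ((hasDerivAt_cos x).const_mul β))).fun_sub ((H.deriv_v₁ x).fun_mul
      (((hasDerivAt_cos x).const_mul α).fun_add ((hasDerivAt_sin x).const_mul β)))).congr_deriv ?_
    ring
  have hy : ∀ α β s : ℝ, HasDerivAt (fun s => (α * cos (τ s) + β * sin (τ s)) / v (τ s))
      (v (τ s) * (-α * sin (τ s) + β * cos (τ s)) -
        v₁ (τ s) * (α * cos (τ s) + β * sin (τ s))) s := by
    intro α β s
    refine ((hX α β (τ s)).comp s (hτ s)).congr_deriv ?_
    have := hv0 (τ s)
    field_simp
  have hz : ∀ α β s : ℝ, HasDerivAt (fun s => v (τ s) * (-α * sin (τ s) + β * cos (τ s)) -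
      v₁ (τ s) * (α * cos (τ s) + β * sin (τ s)))
      (-(k (τ s) * ((α * cos (τ s) + β * sin (τ s)) / v (τ s)))) s := by
    intro α β s
    refine ((hZ α β (τ s)).comp s (hτ s)).congr_deriv ?_
    have := hv0 (τ s)
    rw [H.k_eq]
    field_simp
  have hy0 : ∀ α β : ℝ, ∫ s in (0 : ℝ)..(2 * π), (α * cos (τ s) + β * sin (τ s)) / v (τ s) = 0 := by
    intro α β
    rw [hint (fun x => (α * cos x + β * sin x) / v x) (Continuous.div (by fun_prop) hcv hv0)]
    have hpt : ∀ x, (α * cos x + β * sin x) / v x * (v x ^ 2)⁻¹ =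
        α * ((v x ^ 3)⁻¹ * cos x) + β * ((v x ^ 3)⁻¹ * sin x) := by
      intro x
      have := hv0 x
      field_simp
    have hc3 : Continuous fun x => (v x ^ 3)⁻¹ :=
      (hcv.pow 3).inv₀ fun x => (pow_pos (H.pos x) 3).ne'
    simp_rw [hpt]
    rw [intervalIntegral.integral_add, intervalIntegral.integral_const_mul,
      intervalIntegral.integral_const_mul, hcos, hsin]
    · simp
    all_goals exact Continuous.intervalIntegrable (by fun_prop) _ _
  have hv2 : v (2 * π) = v 0 := by simpa using H.per_v 0
  have hv12 : v₁ (2 * π) = v₁ 0 := by simpa using H.per_v₁ 0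
  have hk2 : k (2 * π) = k 0 := by simpa using H.per_k 0
  have hB : BalancedHill (fun s => k (τ s)) (fun s => k₁ (τ s) * v (τ s) ^ 2)
      (fun s => (v 0 * cos (τ s) + v₁ 0 * sin (τ s)) / v (τ s))
      (fun s => v (τ s) * (-v 0 * sin (τ s) + v₁ 0 * cos (τ s)) -
        v₁ (τ s) * (v 0 * cos (τ s) + v₁ 0 * sin (τ s)))
      (fun s => (0 * cos (τ s) + (v 0)⁻¹ * sin (τ s)) / v (τ s))
      (fun s => v (τ s) * (-0 * sin (τ s) + (v 0)⁻¹ * cos (τ s)) -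
        v₁ (τ s) * (0 * cos (τ s) + (v 0)⁻¹ * sin (τ s))) :=
    { deriv_q := fun s => (H.deriv_k (τ s)).comp s (hτ s)
      cont_q' := by fun_prop
      per_q := by simp only [hτ0, hτ1, hk2]
      deriv_y₁ := hy _ _
      deriv_z₁ := hz _ _
      deriv_y₂ := hy _ _
      deriv_z₂ := hz _ _
      init_y₁ := by simp [hτ0, hv0]
      init_z₁ := by simp [hτ0]; ring
      init_y₂ := by simp [hτ0]
      init_z₂ := by simp [hτ0, hv0]
      per_y₁ := by simp [hτ0, hτ1, hv2]
      per_z₁ := by simp [hτ0, hτ1, hv2, hv12]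
      per_y₂ := by simp [hτ0, hτ1]
      per_z₂ := by simp [hτ0, hτ1, hv2]
      mean_y₁ := hy0 _ _
      mean_y₂ := hy0 _ _ }
  have i1 := hint (fun x => k x - c) (by fun_prop)
  have i2 := hint (fun x => (k x - c) ^ 2) (by fun_prop)
  have i3 := hint (fun x => (k x - c) ^ 3) (by fun_prop)
  have i4 := hint (fun x => (k₁ x * v x ^ 2) ^ 2) (by fun_prop)
  have i5 : ∀ x, (k₁ x * v x ^ 2) ^ 2 * (v x ^ 2)⁻¹ = k₁ x ^ 2 * v x ^ 2 := by
    intro x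
    have := hv0 x
    field_simp
  simp only [i5] at i4
  have := hB.dissipation_le hc (i1.trans hmean) (by rw [i2]; exact hsmall)
  rwa [i2, i3, i4] at this

lemma exists_unit_orthogonal (a b : ℝ) : ∃ α β : ℝ, α ^ 2 + β ^ 2 = 1 ∧ α * a + β * b = 0 := by
  by_cases h : a ^ 2 + b ^ 2 = 0
  · have ha : a = 0 := by nlinarith [sq_nonneg a, sq_nonneg b]
    have hb : b = 0 := by nlinarith [sq_nonneg a, sq_nonneg b]
    exact ⟨1, 0, by norm_num, by simp [ha]⟩
  · have hpos : 0 < a ^ 2 + b ^ 2 := lt_of_le_of_ne (by positivity) (Ne.symm h)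
    have hr := Real.sq_sqrt hpos.le
    have hr0 : √(a ^ 2 + b ^ 2) ≠ 0 := (Real.sqrt_pos.2 hpos).ne'
    refine ⟨b / √(a ^ 2 + b ^ 2), -a / √(a ^ 2 + b ^ 2), ?_, ?_⟩
    · rw [div_pow, div_pow, hr, ← add_div, neg_sq, add_comm, div_self h]
    · field_simp
      ring

/-- If the mean affine curvature exceeds one then the curvature deviation is bounded below. -/
lemma sq_sub_one_le (H : AffineMetric v v₁ v₂ k k₁) {c : ℝ} (hc : 1 ≤ c) :
    π * (c - 1) ^ 2 ≤ 2 * ∫ x in (0 : ℝ)..(2 * π), (k x - c) ^ 2 * (v x ^ 2)⁻¹ := by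
  have hv0 : ∀ x, v x ≠ 0 := fun x => (H.pos x).ne'
  have hcv := H.cont_v
  have hcv₁ := H.cont_v₁
  have hcv₂ := H.cont_v₂
  have hck := H.cont_k
  have hcρ := H.cont_density
  have hcvi : Continuous fun x => (v x)⁻¹ := hcv.inv₀ hv0
  set σ : ℝ → ℝ := fun y => ∫ x in (0 : ℝ)..y, (v x ^ 2)⁻¹ with hσdef
  have hσ : ∀ y, HasDerivAt σ (v y ^ 2)⁻¹ y := fun y =>
    intervalIntegral.integral_hasDerivAt_right (hcρ.intervalIntegrable _ _)
      (hcρ.stronglyMeasurableAtFilter _ _) hcρ.continuousAt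
  have hcσ : Continuous σ := continuous_iff_continuousAt.2 fun x => (hσ x).continuousAt
  have hσ0 : σ 0 = 0 := by simp [hσdef]
  have hσ1 : σ (2 * π) = 2 * π := H.mass
  obtain ⟨α, β, hαβ, horth⟩ := exists_unit_orthogonal
    (∫ x in (0 : ℝ)..(2 * π), v x * cos (σ x)) (∫ x in (0 : ℝ)..(2 * π), v x * sin (σ x))
  set f : ℝ → ℝ := fun x => α * cos (σ x) + β * sin (σ x) with hfdef
  set g : ℝ → ℝ := fun x => -α * sin (σ x) + β * cos (σ x) with hgdef
  have hcf : Continuous f := by fun_prop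
  have hcg : Continuous g := by fun_prop
  have hf : ∀ x, HasDerivAt f (g x * (v x ^ 2)⁻¹) x := by
    intro x
    refine (((hσ x).cos.const_mul α).fun_add ((hσ x).sin.const_mul β)).congr_deriv ?_
    simp only [hgdef]
    ring
  have hg : ∀ x, HasDerivAt g (-f x * (v x ^ 2)⁻¹) x := by
    intro x
    refine (((hσ x).sin.const_mul (-α)).fun_add ((hσ x).cos.const_mul β)).congr_deriv ?_
    simp only [hfdef]
    ring
  have hfg : ∀ x, f x ^ 2 + g x ^ 2 = 1 := by
    intro x
    simp only [hfdef, hgdef]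
    linear_combination (α ^ 2 + β ^ 2) * Real.sin_sq_add_cos_sq (σ x) + hαβ
  have hf2 : f (2 * π) = f 0 := by simp [hfdef, hσ0, hσ1]
  have hg2 : g (2 * π) = g 0 := by simp [hgdef, hσ0, hσ1]
  have hv2 : v (2 * π) = v 0 := by simpa using H.per_v 0
  have hv12 : v₁ (2 * π) = v₁ 0 := by simpa using H.per_v₁ 0
  have hint : ∀ F : ℝ → ℝ, Continuous F → IntervalIntegrable F volume 0 (2 * π) :=
    fun F hF => hF.intervalIntegrable _ _
  have hsum : (∫ x in (0 : ℝ)..(2 * π), f x ^ 2 * (v x ^ 2)⁻¹) +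
      (∫ x in (0 : ℝ)..(2 * π), g x ^ 2 * (v x ^ 2)⁻¹) = 2 * π := by
    refine Eq.trans ?_ H.mass
    rw [← intervalIntegral.integral_add (hint _ (by fun_prop)) (hint _ (by fun_prop))]
    refine intervalIntegral.integral_congr fun x _ => ?_
    rw [← add_mul, hfg, one_mul]
  have hdiff : (∫ x in (0 : ℝ)..(2 * π), g x ^ 2 * (v x ^ 2)⁻¹) -
      (∫ x in (0 : ℝ)..(2 * π), f x ^ 2 * (v x ^ 2)⁻¹) = 0 := by
    rw [← intervalIntegral.integral_sub (hint _ (by fun_prop)) (hint _ (by fun_prop)),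
      intervalIntegral.integral_eq_sub_of_hasDerivAt (f := fun x => f x * g x)
        (fun x _ => ((hf x).fun_mul (hg x)).congr_deriv (by ring)) (hint _ (by fun_prop)),
      hf2, hg2, sub_self]
  have hw : ∀ x, HasDerivAt (fun x => v x * f x) (v₁ x * f x + g x * (v x)⁻¹) x := by
    intro x
    refine ((H.deriv_v x).fun_mul (hf x)).congr_deriv ?_
    have := hv0 x
    field_simp
  have hwir := wirtinger hw (by fun_prop) (by rw [hv2, hf2]) (by
    refine Eq.trans ?_ horth
    rw [← intervalIntegral.integral_const_mul, ← intervalIntegral.integral_const_mul,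
      ← intervalIntegral.integral_add (hint _ (by fun_prop)) (hint _ (by fun_prop))]
    refine intervalIntegral.integral_congr fun x _ => ?_
    simp only [hfdef]
    ring)
  have hbd : ∫ x in (0 : ℝ)..(2 * π), ((v₁ x * f x + g x * (v x)⁻¹) ^ 2 - (v x * f x) ^ 2 -
      g x ^ 2 * (v x ^ 2)⁻¹ + c * (f x ^ 2 * (v x ^ 2)⁻¹) +
      ((k x - c) * (v x)⁻¹) * (f x ^ 2 * (v x)⁻¹)) = 0 := by
    rw [intervalIntegral.integral_eq_sub_of_hasDerivAt (f := fun x => v₁ x * v x * f x ^ 2)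
        (fun x _ => (((H.deriv_v₁ x).fun_mul (H.deriv_v x)).fun_mul ((hf x).fun_pow 2)).congr_deriv
          (by
            have := hv0 x
            rw [H.k_eq]
            field_simp
            push_cast
            ring)) (hint _ (by fun_prop)),
      hf2, hv2, hv12, sub_self]
  rw [intervalIntegral.integral_add (hint _ (by fun_prop)) (hint _ (by fun_prop)),
    intervalIntegral.integral_add (hint _ (by fun_prop)) (hint _ (by fun_prop)),
    intervalIntegral.integral_sub (hint _ (by fun_prop)) (hint _ (by fun_prop)),
    intervalIntegral.integral_sub (hint _ (by fun_prop)) (hint _ (by fun_prop)),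
    intervalIntegral.integral_const_mul] at hbd
  have hcs := sq_intervalIntegral_mul_le (f := fun x => (k x - c) * (v x)⁻¹)
    (g := fun x => f x ^ 2 * (v x)⁻¹) (by fun_prop) (by fun_prop) Real.two_pi_pos.le
  have hE : ∫ x in (0 : ℝ)..(2 * π), ((k x - c) * (v x)⁻¹) ^ 2 =
      ∫ x in (0 : ℝ)..(2 * π), (k x - c) ^ 2 * (v x ^ 2)⁻¹ := by
    simp only [mul_pow, inv_pow]
  have hf4 : ∫ x in (0 : ℝ)..(2 * π), (f x ^ 2 * (v x)⁻¹) ^ 2 ≤ 2 * π := by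
    refine le_trans ?_ H.mass.le
    refine intervalIntegral.integral_mono_on Real.two_pi_pos.le (hint _ (by fun_prop))
      (hint _ (by fun_prop)) fun x _ => ?_
    have h1 : 0 ≤ (v x ^ 2)⁻¹ := (inv_pos.2 (pow_pos (H.pos x) 2)).le
    have h2 : f x ^ 2 ≤ 1 := by nlinarith [hfg x, sq_nonneg (g x)]
    rw [mul_pow, inv_pow]
    exact mul_le_of_le_one_left h1 (pow_le_one₀ (sq_nonneg _) h2)
  rw [hE] at hcs
  have hE0 : 0 ≤ ∫ x in (0 : ℝ)..(2 * π), (k x - c) ^ 2 * (v x ^ 2)⁻¹ :=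
    intervalIntegral.integral_nonneg Real.two_pi_pos.le fun x _ =>
      mul_nonneg (sq_nonneg _) (inv_pos.2 (pow_pos (H.pos x) 2)).le
  have hfpi : ∫ x in (0 : ℝ)..(2 * π), f x ^ 2 * (v x ^ 2)⁻¹ = π := by linarith
  have hgpi : ∫ x in (0 : ℝ)..(2 * π), g x ^ 2 * (v x ^ 2)⁻¹ = π := by linarith
  rw [hfpi, hgpi] at hbd
  have hpi := Real.pi_pos
  have hJ : π * (c - 1) ≤ -∫ x in (0 : ℝ)..(2 * π), (k x - c) * (v x)⁻¹ * (f x ^ 2 * (v x)⁻¹) := by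
    linarith
  have hsq := pow_le_pow_left₀ (mul_nonneg hpi.le (by linarith)) hJ 2
  rw [neg_sq] at hsq
  have hfin := hsq.trans (hcs.trans (mul_le_mul_of_nonneg_left hf4 hE0))
  have : π * (π * (c - 1) ^ 2) ≤
      π * (2 * ∫ x in (0 : ℝ)..(2 * π), (k x - c) ^ 2 * (v x ^ 2)⁻¹) := by linarith
  exact le_of_mul_le_mul_left this hpi

end AffineMetric

lemma le_one_of_riccati {c c' : ℝ → ℝ} (hc : ∀ t, 0 ≤ t → HasDerivAt c (c' t) t)
    (hc0 : ∀ t, 0 ≤ t → 0 ≤ c' t) {γ : ℝ} (hγ : 0 < γ)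
    (hric : ∀ t, 0 ≤ t → 1 ≤ c t → γ * (c t - 1) ^ 2 ≤ c' t) {t : ℝ} (ht : 0 ≤ t) : c t ≤ 1 := by
  by_contra! h1
  have hmono : MonotoneOn c (Set.Ici 0) := by
    refine monotoneOn_of_hasDerivWithinAt_nonneg (convex_Ici 0)
      (fun s hs => (hc s hs).continuousAt.continuousWithinAt)
      (fun s hs => (hc s (interior_subset hs)).hasDerivWithinAt)
      fun s hs => hc0 s (interior_subset hs)
  have hgt : ∀ s, t ≤ s → 1 < c s := fun s hs => h1.trans_le (hmono ht (ht.trans hs) hs)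
  have hanti : AntitoneOn (fun s => (c s - 1)⁻¹ + γ * s) (Set.Ici t) := by
    refine antitoneOn_of_hasDerivWithinAt_nonpos (f' := fun s => -c' s / (c s - 1) ^ 2 + γ * 1)
      (convex_Ici t) (fun s hs => ?_) (fun s hs => ?_) fun s hs => ?_
    · have hne : c s - 1 ≠ 0 := (sub_pos.2 (hgt s hs)).ne'
      exact (((hc s (ht.trans hs)).continuousAt.sub continuousAt_const).inv₀ hne).continuousWithinAt.add
        (by fun_prop)
    · have hs' : t ≤ s := interior_subset hs
      have hne : c s - 1 ≠ 0 := (sub_pos.2 (hgt s hs')).ne'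
      exact ((((hc s (ht.trans hs')).sub_const 1).fun_inv hne).fun_add
        ((hasDerivAt_id s).const_mul γ)).hasDerivWithinAt
    · have hs' : t ≤ s := interior_subset hs
      have hpos : 0 < (c s - 1) ^ 2 := pow_pos (sub_pos.2 (hgt s hs')) 2
      have := hric s (ht.trans hs') (hgt s hs').le
      rw [neg_div, mul_one, neg_add_nonpos_iff, le_div_iff₀ hpos]
      exact this
  have hv : 0 < (c t - 1)⁻¹ := inv_pos.2 (sub_pos.2 h1)
  have hs : t ≤ t + (c t - 1)⁻¹ / γ := le_add_of_nonneg_right (by positivity)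
  have h2 := hanti (Set.mem_Ici.2 le_rfl) hs hs
  have h3 : 0 < (c (t + (c t - 1)⁻¹ / γ) - 1)⁻¹ := inv_pos.2 (sub_pos.2 (hgt _ hs))
  simp only [mul_add, mul_div_cancel₀ _ hγ.ne'] at h2
  linarith

lemma exists_lt_of_deriv_of_le {c E : ℝ → ℝ} {γ : ℝ} (hγ : 0 < γ)
    (hc : ∀ t, 0 ≤ t → HasDerivAt c (γ * E t) t) {M : ℝ} (hM : ∀ t, 0 ≤ t → c t ≤ M)
    {ε : ℝ} (hε : 0 < ε) : ∃ t, 0 ≤ t ∧ E t < ε := by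
  by_contra! h
  have hmono : MonotoneOn (fun t => c t - γ * ε * t) (Set.Ici 0) := by
    refine monotoneOn_of_hasDerivWithinAt_nonneg (f' := fun s => γ * E s - γ * ε * 1) (convex_Ici 0)
      (fun s hs => ?_) (fun s hs => ?_) fun s hs => ?_
    · exact (hc s hs).continuousAt.continuousWithinAt.sub (by fun_prop)
    · exact ((hc s (interior_subset hs)).fun_sub
        ((hasDerivAt_id s).const_mul (γ * ε))).hasDerivWithinAt
    · nlinarith [h s (interior_subset hs)]
  have hs : (0 : ℝ) ≤ (|M - c 0| + 1) / (γ * ε) := by positivity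
  have h1 := hmono (Set.mem_Ici.2 le_rfl) hs hs
  have h2 := hM _ hs
  simp only [mul_zero, sub_zero, mul_div_cancel₀ _ (mul_pos hγ hε).ne'] at h1
  linarith [le_abs_self (M - c 0)]

lemma exp_decay_of_small {E E' : ℝ → ℝ} (hE : ∀ t, 0 ≤ t → HasDerivAt E (E' t) t)
    {ε : ℝ} (hε : 0 < ε) (hdec : ∀ t, 0 ≤ t → E t ≤ ε → E' t ≤ -E t)
    {t₀ : ℝ} (ht₀ : 0 ≤ t₀) (hsmall : E t₀ ≤ ε) :
    ∃ C a : ℝ, 0 < C ∧ 0 < a ∧ ∀ t : ℝ, 0 ≤ t → E t ≤ C * exp (-a * t) := by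
  have hcE : ∀ t, 0 ≤ t → ContinuousAt E t := fun t ht => (hE t ht).continuousAt
  have hstay : ∀ t, t₀ ≤ t → E t ≤ ε := by
    intro t ht
    refine image_le_of_deriv_right_lt_deriv_boundary (a := t₀) (b := t) (f' := E')
      (B := fun _ => ε) (B' := fun _ => 0)
      (fun s hs => (hcE s (ht₀.trans hs.1)).continuousWithinAt)
      (fun s hs => (hE s (ht₀.trans hs.1)).hasDerivWithinAt) hsmall
      (fun s => hasDerivAt_const s ε) (fun s hs h => ?_) ⟨ht, le_rfl⟩
    have := hdec s (ht₀.trans hs.1) h.le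
    linarith
  have hanti : AntitoneOn (fun t => E t * exp t) (Set.Ici t₀) := by
    refine antitoneOn_of_hasDerivWithinAt_nonpos (f' := fun s => E' s * exp s + E s * exp s)
      (convex_Ici t₀) (fun s hs => ?_) (fun s hs => ?_) fun s hs => ?_
    · exact ((hcE s (ht₀.trans hs)).mul (by fun_prop)).continuousWithinAt
    · exact ((hE s (ht₀.trans (interior_subset hs))).fun_mul
        (Real.hasDerivAt_exp s)).hasDerivWithinAt
    · have hs' : t₀ ≤ s := interior_subset hs
      have := hdec s (ht₀.trans hs') (hstay s hs')
      rw [← add_mul]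
      exact mul_nonpos_of_nonpos_of_nonneg (by linarith) (exp_pos s).le
  obtain ⟨M, hM⟩ := (isCompact_Icc (a := (0 : ℝ)) (b := t₀)).exists_bound_of_continuousOn
    (f := fun t => E t * exp t) (fun s hs =>
      ((hcE s hs.1).mul (by fun_prop)).continuousWithinAt)
  refine ⟨|M| + 1, 1, by positivity, one_pos, fun t ht => ?_⟩
  have hbound : E t * exp t ≤ |M| + 1 := by
    have hM' : ∀ s ∈ Set.Icc 0 t₀, E s * exp s ≤ |M| + 1 := fun s hs => by
      have h1 := (le_abs_self _).trans (hM s hs)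
      linarith [le_abs_self M]
    rcases le_total t t₀ with h | h
    · exact hM' t ⟨ht, h⟩
    · exact (hanti (Set.mem_Ici.2 le_rfl) h h).trans (hM' t₀ ⟨ht₀, le_rfl⟩)
  rw [neg_one_mul, Real.exp_neg, ← div_eq_mul_inv, le_div_iff₀ (exp_pos t)]
  exact hbound

section PartialDerivatives

/-- The partial derivative of `f` in its first variable. -/
noncomputable def partialFst (f : ℝ × ℝ → ℝ) (p : ℝ × ℝ) : ℝ := fderiv ℝ f p (1, 0)

/-- The partial derivative of `f` in its second variable. -/
noncomputable def partialSnd (f : ℝ × ℝ → ℝ) (p : ℝ × ℝ) : ℝ := fderiv ℝ f p (0, 1)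

variable {f : ℝ × ℝ → ℝ}

lemma contDiff_partialFst (hf : ContDiff ℝ (⊤ : ℕ∞) f) :
    ContDiff ℝ (⊤ : ℕ∞) (partialFst f) :=
  (hf.fderiv_right (m := (⊤ : ℕ∞)) (by simp)).clm_apply contDiff_const

lemma contDiff_partialSnd (hf : ContDiff ℝ (⊤ : ℕ∞) f) :
    ContDiff ℝ (⊤ : ℕ∞) (partialSnd f) :=
  (hf.fderiv_right (m := (⊤ : ℕ∞)) (by simp)).clm_apply contDiff_const

lemma hasDerivAt_partialFst (hf : ContDiff ℝ (⊤ : ℕ∞) f) (x t : ℝ) :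
    HasDerivAt (fun y => f (y, t)) (partialFst f (x, t)) x :=
  (hf.differentiable (by simp) (x, t)).hasFDerivAt.comp_hasDerivAt x
    ((hasDerivAt_id x).prodMk (hasDerivAt_const x t))

lemma hasDerivAt_partialSnd (hf : ContDiff ℝ (⊤ : ℕ∞) f) (x t : ℝ) :
    HasDerivAt (fun s => f (x, s)) (partialSnd f (x, t)) t :=
  (hf.differentiable (by simp) (x, t)).hasFDerivAt.comp_hasDerivAt t
    ((hasDerivAt_const t x).prodMk (hasDerivAt_id t))

lemma partialSnd_partialFst (hf : ContDiff ℝ (⊤ : ℕ∞) f) (p : ℝ × ℝ) :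
    partialSnd (partialFst f) p = partialFst (partialSnd f) p := by
  have hd : DifferentiableAt ℝ (fderiv ℝ f) p :=
    (hf.fderiv_right (m := (⊤ : ℕ∞)) (by simp)).differentiable (by simp) p
  have hsymm : IsSymmSndFDerivAt ℝ f p :=
    hf.contDiffAt.isSymmSndFDerivAt
      (by simpa using WithTop.coe_le_coe.2 (le_top : (2 : ℕ∞) ≤ ⊤))
  have happ : ∀ v w : ℝ × ℝ, fderiv ℝ (fun q => fderiv ℝ f q v) p w =
      fderiv ℝ (fderiv ℝ f) p w v := fun v w => by
    rw [(hd.hasFDerivAt.clm_apply (hasFDerivAt_const v p)).fderiv]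
    simp
  exact (happ _ _).trans ((hsymm _ _).trans (happ _ _).symm)

lemma partialFst_periodic {T : ℝ} (hf : ContDiff ℝ (⊤ : ℕ∞) f)
    (hper : ∀ x t, f (x + T, t) = f (x, t)) (x t : ℝ) :
    partialFst f (x + T, t) = partialFst f (x, t) := by
  refine HasDerivAt.unique ?_ (hasDerivAt_partialFst hf x t)
  have h := (hasDerivAt_partialFst hf (x + T) t).comp_add_const x T
  exact h.congr_of_eventuallyEq (Filter.Eventually.of_forall fun y => (hper y t).symm)

lemma hasDerivAt_integral_partialSnd (hf : ContDiff ℝ (⊤ : ℕ∞) f) (a b t : ℝ) :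
    HasDerivAt (fun s => ∫ x in a..b, f (x, s)) (∫ x in a..b, partialSnd f (x, t)) t := by
  have hf' := (contDiff_partialSnd hf).continuous
  have hfc := hf.continuous
  obtain ⟨M, hM⟩ := ((isCompact_uIcc (a := a) (b := b)).prod
    (isCompact_Icc (a := t - 1) (b := t + 1))).exists_bound_of_continuousOn hf'.continuousOn
  refine (intervalIntegral.hasDerivAt_integral_of_dominated_loc_of_deriv_le
    (F := fun s x => f (x, s)) (F' := fun s x => partialSnd f (x, s)) (bound := fun _ => M)
    (Icc_mem_nhds (sub_one_lt t) (lt_add_one t)) ?_ ?_ ?_ ?_ ?_ ?_).2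
  · exact Filter.Eventually.of_forall fun s =>
      (hfc.comp (by fun_prop : Continuous fun x : ℝ => (x, s))).aestronglyMeasurable
  · exact (hfc.comp (by fun_prop : Continuous fun x : ℝ => (x, t))).intervalIntegrable _ _
  · exact (hf'.comp (by fun_prop : Continuous fun x : ℝ => (x, t))).aestronglyMeasurable
  · exact Filter.Eventually.of_forall fun x hx s hs =>
      hM (x, s) ⟨Set.uIoc_subset_uIcc hx, hs⟩
  · exact intervalIntegrable_const
  · exact Filter.Eventually.of_forall fun x _ s _ => hasDerivAt_partialSnd hf x s

end PartialDerivatives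

lemma integral_eq_of_hasDerivAt_sub {f g P : ℝ → ℝ} {a b : ℝ} (hf : Continuous f)
    (hg : Continuous g) (hP : ∀ x, HasDerivAt P (f x - g x) x) (hab : P b = P a) :
    ∫ x in a..b, f x = ∫ x in a..b, g x := by
  have h := intervalIntegral.integral_eq_sub_of_hasDerivAt (fun x _ => hP x)
    ((hf.sub hg).intervalIntegrable a b)
  rw [intervalIntegral.integral_sub (hf.intervalIntegrable a b) (hg.intervalIntegrable a b)] at h
  linarith

/-- The affine curvature `U³ (∂²U + U)`, the derivative being taken in the first variable. -/
noncomputable def affineCurvature (U : ℝ × ℝ → ℝ) (p : ℝ × ℝ) : ℝ :=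
  U p ^ 3 * (partialFst (partialFst U) p + U p)

/-- A smooth positive solution, `2π`-periodic in its first variable, of the affine flow
normalized to total length `2π`, with mean curvature `c t` at time `t`. -/
structure NormalizedAffineFlow (U : ℝ × ℝ → ℝ) (c : ℝ → ℝ) : Prop where
  smooth : ContDiff ℝ (⊤ : ℕ∞) U
  periodic : ∀ x t, U (x + 2 * π, t) = U (x, t)
  pos : ∀ p, 0 < U p
  mean : ∀ t, c t = (∫ x in (0 : ℝ)..(2 * π), affineCurvature U (x, t) * (U (x, t) ^ 2)⁻¹) /
    ∫ x in (0 : ℝ)..(2 * π), (U (x, t) ^ 2)⁻¹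
  flow : ∀ x t, 0 ≤ t →
    partialSnd U (x, t) = 1 / 4 * (affineCurvature U (x, t) - c t) * U (x, t)
  mass_zero : ∫ x in (0 : ℝ)..(2 * π), (U (x, 0) ^ 2)⁻¹ = 2 * π

namespace NormalizedAffineFlow

variable {U : ℝ × ℝ → ℝ} {c : ℝ → ℝ}

lemma contDiff_curvature (H : NormalizedAffineFlow U c) :
    ContDiff ℝ (⊤ : ℕ∞) (affineCurvature U) :=
  (H.smooth.pow 3).mul ((contDiff_partialFst (contDiff_partialFst H.smooth)).add H.smooth)

lemma contDiff_density (H : NormalizedAffineFlow U c) :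
    ContDiff ℝ (⊤ : ℕ∞) fun p => (U p ^ 2)⁻¹ :=
  (H.smooth.pow 2).inv fun p => (pow_pos (H.pos p) 2).ne'

lemma curvature_periodic (H : NormalizedAffineFlow U c) (x t : ℝ) :
    affineCurvature U (x + 2 * π, t) = affineCurvature U (x, t) := by
  unfold affineCurvature
  rw [H.periodic, partialFst_periodic (contDiff_partialFst H.smooth)
    (partialFst_periodic H.smooth H.periodic)]

lemma partialSnd_curvature (H : NormalizedAffineFlow U c) (x : ℝ) {t : ℝ} (ht : 0 ≤ t) :
    partialSnd (affineCurvature U) (x, t) =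
      affineCurvature U (x, t) * (affineCurvature U (x, t) - c t) +
      1 / 4 * (U (x, t) ^ 4 * partialFst (partialFst (affineCurvature U)) (x, t) +
        2 * U (x, t) ^ 3 * partialFst U (x, t) * partialFst (affineCurvature U) (x, t)) := by
  have hU := H.smooth
  have hk := H.contDiff_curvature
  have hU₁ := contDiff_partialFst hU
  have hk₁ := contDiff_partialFst hk
  have h₁ : ∀ y, partialFst (partialSnd U) (y, t) =
      1 / 4 * partialFst (affineCurvature U) (y, t) * U (y, t) +
        1 / 4 * (affineCurvature U (y, t) - c t) * partialFst U (y, t) := fun y => by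
    refine (hasDerivAt_partialFst (contDiff_partialSnd hU) y t).unique ?_
    rw [funext fun z => H.flow z t ht]
    exact (((hasDerivAt_partialFst hk y t).sub_const (c t)).const_mul (1 / 4)).fun_mul
      (hasDerivAt_partialFst hU y t)
  have h₂ : partialFst (partialFst (partialSnd U)) (x, t) =
      1 / 4 * (partialFst (partialFst (affineCurvature U)) (x, t) * U (x, t) +
        2 * partialFst (affineCurvature U) (x, t) * partialFst U (x, t) +
        (affineCurvature U (x, t) - c t) * partialFst (partialFst U) (x, t)) := by
    refine (hasDerivAt_partialFst (contDiff_partialFst (contDiff_partialSnd hU)) x t).unique ?_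
    rw [funext h₁]
    refine ((((hasDerivAt_partialFst hk₁ x t).const_mul (1 / 4)).fun_mul
      (hasDerivAt_partialFst hU x t)).fun_add
      ((((hasDerivAt_partialFst hk x t).sub_const (c t)).const_mul (1 / 4)).fun_mul
      (hasDerivAt_partialFst hU₁ x t))).congr_deriv ?_
    ring
  have h₃ : partialSnd (partialFst (partialFst U)) (x, t) =
      partialFst (partialFst (partialSnd U)) (x, t) := by
    rw [partialSnd_partialFst hU₁, funext (partialSnd_partialFst hU)]
  have h₄ : HasDerivAt (fun s => affineCurvature U (x, s))
      (3 * U (x, t) ^ 2 * partialSnd U (x, t) * (partialFst (partialFst U) (x, t) + U (x, t)) +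
        U (x, t) ^ 3 * (partialSnd (partialFst (partialFst U)) (x, t) + partialSnd U (x, t))) t :=
    (((hasDerivAt_partialSnd hU x t).fun_pow 3).fun_mul
      ((hasDerivAt_partialSnd (contDiff_partialFst hU₁) x t).fun_add
        (hasDerivAt_partialSnd hU x t))).congr_deriv (by norm_num)
  rw [(hasDerivAt_partialSnd hk x t).unique h₄, h₃, h₂, H.flow x t ht]
  have hdef : affineCurvature U (x, t) =
      U (x, t) ^ 3 * (partialFst (partialFst U) (x, t) + U (x, t)) := rfl
  linear_combination (-(affineCurvature U (x, t) - c t)) * hdef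

lemma hasDerivAt_integral_density (H : NormalizedAffineFlow U c) {F : ℝ × ℝ → ℝ}
    (hF : ContDiff ℝ (⊤ : ℕ∞) F) {t : ℝ} (ht : 0 ≤ t) :
    HasDerivAt (fun s => ∫ x in (0 : ℝ)..(2 * π), F (x, s) * (U (x, s) ^ 2)⁻¹)
      (∫ x in (0 : ℝ)..(2 * π), (partialSnd F (x, t) -
        1 / 2 * (affineCurvature U (x, t) - c t) * F (x, t)) * (U (x, t) ^ 2)⁻¹) t := by
  refine (hasDerivAt_integral_partialSnd (hF.mul H.contDiff_density) 0 (2 * π) t).congr_deriv ?_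
  refine intervalIntegral.integral_congr fun x _ => ?_
  have hne := (H.pos (x, t)).ne'
  refine (hasDerivAt_partialSnd (hF.mul H.contDiff_density) x t).unique ?_
  refine ((hasDerivAt_partialSnd hF x t).fun_mul
    (((hasDerivAt_partialSnd H.smooth x t).fun_pow 2).fun_inv (pow_ne_zero 2 hne))).congr_deriv ?_
  rw [H.flow x t ht]
  field_simp
  norm_num
  ring

lemma continuous_slices (H : NormalizedAffineFlow U c) (t : ℝ) :
    (Continuous fun x => affineCurvature U (x, t)) ∧ (Continuous fun x => (U (x, t) ^ 2)⁻¹) ∧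
      (Continuous fun x => U (x, t)) ∧
      Continuous fun x => partialFst (affineCurvature U) (x, t) := by
  have hs : Continuous fun x : ℝ => (x, t) := by fun_prop
  exact ⟨H.contDiff_curvature.continuous.comp hs, H.contDiff_density.continuous.comp hs,
    H.smooth.continuous.comp hs, (contDiff_partialFst H.contDiff_curvature).continuous.comp hs⟩

lemma length_pos (H : NormalizedAffineFlow U c) (t : ℝ) :
    0 < ∫ x in (0 : ℝ)..(2 * π), (U (x, t) ^ 2)⁻¹ :=
  intervalIntegral.intervalIntegral_pos_of_pos ((H.continuous_slices t).2.1.intervalIntegrable _ _)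
    (fun x => inv_pos.2 (pow_pos (H.pos (x, t)) 2)) two_pi_pos

lemma mean_mul_length (H : NormalizedAffineFlow U c) (t : ℝ) :
    c t * ∫ x in (0 : ℝ)..(2 * π), (U (x, t) ^ 2)⁻¹ =
      ∫ x in (0 : ℝ)..(2 * π), affineCurvature U (x, t) * (U (x, t) ^ 2)⁻¹ := by
  rw [H.mean t, div_mul_cancel₀ _ (H.length_pos t).ne']

lemma integral_curvature_sub_mean (H : NormalizedAffineFlow U c) (t : ℝ) :
    ∫ x in (0 : ℝ)..(2 * π), (affineCurvature U (x, t) - c t) * (U (x, t) ^ 2)⁻¹ = 0 := by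
  obtain ⟨hk, hρ, -, -⟩ := H.continuous_slices t
  simp_rw [sub_mul]
  rw [intervalIntegral.integral_sub (Continuous.intervalIntegrable (by fun_prop) _ _)
    (Continuous.intervalIntegrable (by fun_prop) _ _), intervalIntegral.integral_const_mul,
    H.mean_mul_length, sub_self]

lemma integral_sq_curvature_sub_mean (H : NormalizedAffineFlow U c) (t : ℝ) :
    ∫ x in (0 : ℝ)..(2 * π), (affineCurvature U (x, t) - c t) ^ 2 * (U (x, t) ^ 2)⁻¹ =
      (∫ x in (0 : ℝ)..(2 * π), affineCurvature U (x, t) ^ 2 * (U (x, t) ^ 2)⁻¹) -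
        c t * ∫ x in (0 : ℝ)..(2 * π), affineCurvature U (x, t) * (U (x, t) ^ 2)⁻¹ := by
  obtain ⟨hk, hρ, -, -⟩ := H.continuous_slices t
  have h := H.integral_curvature_sub_mean t
  have hsplit : ∀ x, (affineCurvature U (x, t) - c t) ^ 2 * (U (x, t) ^ 2)⁻¹ =
      affineCurvature U (x, t) ^ 2 * (U (x, t) ^ 2)⁻¹ -
        c t * (affineCurvature U (x, t) * (U (x, t) ^ 2)⁻¹) -
        c t * ((affineCurvature U (x, t) - c t) * (U (x, t) ^ 2)⁻¹) := fun x => by ring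
  simp_rw [hsplit]
  rw [intervalIntegral.integral_sub (Continuous.intervalIntegrable (by fun_prop) _ _)
    (Continuous.intervalIntegrable (by fun_prop) _ _),
    intervalIntegral.integral_sub (Continuous.intervalIntegrable (by fun_prop) _ _)
    (Continuous.intervalIntegrable (by fun_prop) _ _),
    intervalIntegral.integral_const_mul, intervalIntegral.integral_const_mul, h, mul_zero, sub_zero]

lemma hasDerivAt_length (H : NormalizedAffineFlow U c) {t : ℝ} (ht : 0 ≤ t) :
    HasDerivAt (fun s => ∫ x in (0 : ℝ)..(2 * π), (U (x, s) ^ 2)⁻¹) 0 t := by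
  have h := H.hasDerivAt_integral_density (F := fun _ => 1) contDiff_const ht
  simp only [one_mul] at h
  refine h.congr_deriv ?_
  have hpt : ∀ x, (partialSnd (fun _ => 1) (x, t) -
      1 / 2 * (affineCurvature U (x, t) - c t) * 1) * (U (x, t) ^ 2)⁻¹ =
      -(1 / 2) * ((affineCurvature U (x, t) - c t) * (U (x, t) ^ 2)⁻¹) := fun x => by
    simp [partialSnd]
    ring
  simp_rw [hpt]
  rw [intervalIntegral.integral_const_mul, H.integral_curvature_sub_mean, mul_zero]

lemma length_eq (H : NormalizedAffineFlow U c) {t : ℝ} (ht : 0 ≤ t) :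
    ∫ x in (0 : ℝ)..(2 * π), (U (x, t) ^ 2)⁻¹ = 2 * π := by
  have h := constant_of_has_deriv_right_zero (a := 0) (b := t)
    (fun s hs => (H.hasDerivAt_length hs.1).continuousAt.continuousWithinAt)
    (fun s hs => (H.hasDerivAt_length hs.1).hasDerivWithinAt) t ⟨ht, le_rfl⟩
  exact h.trans H.mass_zero

lemma hasDerivAt_integral_curvature (H : NormalizedAffineFlow U c) {t : ℝ} (ht : 0 ≤ t) :
    HasDerivAt
      (fun s => ∫ x in (0 : ℝ)..(2 * π), affineCurvature U (x, s) * (U (x, s) ^ 2)⁻¹)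
      (1 / 2 * ∫ x in (0 : ℝ)..(2 * π),
        (affineCurvature U (x, t) - c t) ^ 2 * (U (x, t) ^ 2)⁻¹) t := by
  obtain ⟨hk, hρ, hU, hk₁⟩ := H.continuous_slices t
  have hkt : Continuous fun x => partialSnd (affineCurvature U) (x, t) :=
    (contDiff_partialSnd H.contDiff_curvature).continuous.comp (by fun_prop)
  refine (H.hasDerivAt_integral_density H.contDiff_curvature ht).congr_deriv ?_
  have hend := H.periodic 0 t
  have hend' := partialFst_periodic H.contDiff_curvature H.curvature_periodic 0 t
  rw [zero_add] at hend hend'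
  rw [integral_eq_of_hasDerivAt_sub
    (g := fun x => 1 / 2 * ((affineCurvature U (x, t) - c t) ^ 2 * (U (x, t) ^ 2)⁻¹) +
      1 / 2 * c t * ((affineCurvature U (x, t) - c t) * (U (x, t) ^ 2)⁻¹))
    (P := fun x => 1 / 4 * (U (x, t) ^ 2 * partialFst (affineCurvature U) (x, t)))
    (by fun_prop) (by fun_prop) (fun x => ?_) (by simp only [hend, hend'])]
  · rw [intervalIntegral.integral_add (Continuous.intervalIntegrable (by fun_prop) _ _)
      (Continuous.intervalIntegrable (by fun_prop) _ _),
      intervalIntegral.integral_const_mul, intervalIntegral.integral_const_mul,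
      H.integral_curvature_sub_mean, mul_zero, add_zero]
  · have hne := (H.pos (x, t)).ne'
    refine ((((hasDerivAt_partialFst H.smooth x t).fun_pow 2).fun_mul
      (hasDerivAt_partialFst (contDiff_partialFst H.contDiff_curvature) x t)).const_mul
        (1 / 4)).congr_deriv ?_
    rw [H.partialSnd_curvature x ht]
    field_simp
    norm_num
    ring

lemma hasDerivAt_integral_sq_curvature (H : NormalizedAffineFlow U c) {t : ℝ} (ht : 0 ≤ t) :
    HasDerivAt
      (fun s => ∫ x in (0 : ℝ)..(2 * π), affineCurvature U (x, s) ^ 2 * (U (x, s) ^ 2)⁻¹)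
      (3 / 2 * (∫ x in (0 : ℝ)..(2 * π),
          (affineCurvature U (x, t) - c t) ^ 3 * (U (x, t) ^ 2)⁻¹) +
        3 * c t * (∫ x in (0 : ℝ)..(2 * π),
          (affineCurvature U (x, t) - c t) ^ 2 * (U (x, t) ^ 2)⁻¹) -
        1 / 2 * ∫ x in (0 : ℝ)..(2 * π),
          partialFst (affineCurvature U) (x, t) ^ 2 * U (x, t) ^ 2) t := by
  obtain ⟨hk, hρ, hU, hk₁⟩ := H.continuous_slices t
  have hK := H.contDiff_curvature
  have hkt : Continuous fun x => partialSnd (fun p => affineCurvature U p ^ 2) (x, t) :=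
    (contDiff_partialSnd (hK.pow 2)).continuous.comp (by fun_prop)
  refine (H.hasDerivAt_integral_density (hK.pow 2) ht).congr_deriv ?_
  have hcube : Continuous fun x =>
      3 / 2 * ((affineCurvature U (x, t) - c t) ^ 3 * (U (x, t) ^ 2)⁻¹) := by fun_prop
  have hsquare : Continuous fun x =>
      3 * c t * ((affineCurvature U (x, t) - c t) ^ 2 * (U (x, t) ^ 2)⁻¹) := by fun_prop
  have hdiss : Continuous fun x =>
      1 / 2 * (partialFst (affineCurvature U) (x, t) ^ 2 * U (x, t) ^ 2) :=
    continuous_const.mul ((hk₁.pow 2).mul (hU.pow 2))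
  have hlin : Continuous fun x =>
      3 / 2 * c t ^ 2 * ((affineCurvature U (x, t) - c t) * (U (x, t) ^ 2)⁻¹) := by fun_prop
  have hend := H.periodic 0 t
  have hend' := partialFst_periodic hK H.curvature_periodic 0 t
  have hend'' := H.curvature_periodic 0 t
  rw [zero_add] at hend hend' hend''
  rw [integral_eq_of_hasDerivAt_sub
    (g := fun x => 3 / 2 * ((affineCurvature U (x, t) - c t) ^ 3 * (U (x, t) ^ 2)⁻¹) +
      3 * c t * ((affineCurvature U (x, t) - c t) ^ 2 * (U (x, t) ^ 2)⁻¹) -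
      1 / 2 * (partialFst (affineCurvature U) (x, t) ^ 2 * U (x, t) ^ 2) +
      3 / 2 * c t ^ 2 * ((affineCurvature U (x, t) - c t) * (U (x, t) ^ 2)⁻¹))
    (P := fun x => 1 / 2 * (affineCurvature U (x, t) *
      (U (x, t) ^ 2 * partialFst (affineCurvature U) (x, t))))
    (by fun_prop) (((hcube.fun_add hsquare).fun_sub hdiss).fun_add hlin) (fun x => ?_)
    (by simp only [hend, hend', hend''])]
  · rw [intervalIntegral.integral_add
      (((hcube.fun_add hsquare).fun_sub hdiss).intervalIntegrable _ _) (hlin.intervalIntegrable _ _),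
      intervalIntegral.integral_sub ((hcube.fun_add hsquare).intervalIntegrable _ _)
      (hdiss.intervalIntegrable _ _),
      intervalIntegral.integral_add (hcube.intervalIntegrable _ _) (hsquare.intervalIntegrable _ _),
      intervalIntegral.integral_const_mul, intervalIntegral.integral_const_mul,
      intervalIntegral.integral_const_mul, intervalIntegral.integral_const_mul,
      H.integral_curvature_sub_mean, mul_zero, add_zero]
  · have hne := (H.pos (x, t)).ne'
    have hsq : partialSnd (fun p => affineCurvature U p ^ 2) (x, t) =
        2 * affineCurvature U (x, t) * partialSnd (affineCurvature U) (x, t) :=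
      (hasDerivAt_partialSnd (hK.pow 2) x t).unique
        (((hasDerivAt_partialSnd hK x t).fun_pow 2).congr_deriv (by norm_num))
    refine (((hasDerivAt_partialFst hK x t).fun_mul
      (((hasDerivAt_partialFst H.smooth x t).fun_pow 2).fun_mul
      (hasDerivAt_partialFst (contDiff_partialFst hK) x t))).const_mul (1 / 2)).congr_deriv ?_
    rw [hsq, H.partialSnd_curvature x ht]
    field_simp
    norm_num
    ring

lemma hasDerivAt_mean (H : NormalizedAffineFlow U c) {t : ℝ} (ht : 0 ≤ t) :
    HasDerivAt c (1 / (4 * π) * ∫ x in (0 : ℝ)..(2 * π),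
      (affineCurvature U (x, t) - c t) ^ 2 * (U (x, t) ^ 2)⁻¹) t := by
  have h := (H.hasDerivAt_integral_curvature ht).fun_div (H.hasDerivAt_length ht)
    (H.length_pos t).ne'
  rw [← funext H.mean] at h
  refine h.congr_deriv ?_
  rw [H.length_eq ht]
  field_simp
  ring

lemma hasDerivAt_integral_sq_curvature_sub_mean (H : NormalizedAffineFlow U c) {t : ℝ}
    (ht : 0 ≤ t) :
    HasDerivAt
      (fun s => ∫ x in (0 : ℝ)..(2 * π),
        (affineCurvature U (x, s) - c s) ^ 2 * (U (x, s) ^ 2)⁻¹)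
      (3 / 2 * (∫ x in (0 : ℝ)..(2 * π),
          (affineCurvature U (x, t) - c t) ^ 3 * (U (x, t) ^ 2)⁻¹) +
        2 * c t * (∫ x in (0 : ℝ)..(2 * π),
          (affineCurvature U (x, t) - c t) ^ 2 * (U (x, t) ^ 2)⁻¹) -
        1 / 2 * ∫ x in (0 : ℝ)..(2 * π),
          partialFst (affineCurvature U) (x, t) ^ 2 * U (x, t) ^ 2) t := by
  rw [funext H.integral_sq_curvature_sub_mean]
  refine ((H.hasDerivAt_integral_sq_curvature ht).fun_sub
    ((H.hasDerivAt_mean ht).fun_mul (H.hasDerivAt_integral_curvature ht))).congr_deriv ?_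
  rw [← H.mean_mul_length t, H.length_eq ht]
  field_simp
  ring

lemma integral_cube_mul_eq_zero (H : NormalizedAffineFlow U c) {φ φ' : ℝ → ℝ}
    (hφ : ∀ x, HasDerivAt φ (φ' x) x) (hφ' : ∀ x, HasDerivAt φ' (-φ x) x)
    (hsmooth : ContDiff ℝ (⊤ : ℕ∞) φ)
    (hper : φ (2 * π) = φ 0) (hper' : φ' (2 * π) = φ' 0)
    (hzero : ∫ x in (0 : ℝ)..(2 * π), (U (x, 0) ^ 3)⁻¹ * φ x = 0) {t : ℝ} (ht : 0 ≤ t) :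
    ∫ x in (0 : ℝ)..(2 * π), (U (x, t) ^ 3)⁻¹ * φ x = 0 := by
  have hcube : ContDiff ℝ (⊤ : ℕ∞) fun p => (U p ^ 3)⁻¹ :=
    (H.smooth.pow 3).inv fun p => (pow_pos (H.pos p) 3).ne'
  have hF : ContDiff ℝ (⊤ : ℕ∞) fun p : ℝ × ℝ => (U p ^ 3)⁻¹ * φ p.1 :=
    hcube.mul (hsmooth.comp contDiff_fst)
  have hderiv : ∀ s, 0 ≤ s → HasDerivAt
      (fun r => ∫ x in (0 : ℝ)..(2 * π), (U (x, r) ^ 3)⁻¹ * φ x)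
      (3 / 4 * c s * ∫ x in (0 : ℝ)..(2 * π), (U (x, s) ^ 3)⁻¹ * φ x) s := fun s hs => by
    refine (hasDerivAt_integral_partialSnd hF 0 (2 * π) s).congr_deriv ?_
    have hslice : Continuous fun x : ℝ => (x, s) := by fun_prop
    have hend := H.periodic 0 s
    have hend' := partialFst_periodic H.smooth H.periodic 0 s
    rw [zero_add] at hend hend'
    have hcont : Continuous fun x => (U (x, s) ^ 3)⁻¹ * φ x := hF.continuous.comp hslice
    rw [← intervalIntegral.integral_const_mul]
    refine integral_eq_of_hasDerivAt_sub
      (P := fun x => -(3 / 4) * (partialFst U (x, s) * φ x - U (x, s) * φ' x))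
      ((contDiff_partialSnd hF).continuous.comp hslice) (by fun_prop) (fun x => ?_)
      (by simp only [hend, hend', hper, hper'])
    have hne := (H.pos (x, s)).ne'
    have hpt : partialSnd (fun p : ℝ × ℝ => (U p ^ 3)⁻¹ * φ p.1) (x, s) =
        -(3 / 4) * (affineCurvature U (x, s) - c s) * (U (x, s) ^ 3)⁻¹ * φ x := by
      refine (hasDerivAt_partialSnd hF x s).unique ?_
      refine ((((hasDerivAt_partialSnd H.smooth x s).fun_pow 3).fun_inv
        (pow_ne_zero 3 hne)).mul_const (φ x)).congr_deriv ?_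
      rw [H.flow x s hs]
      field_simp
      norm_num
      ring
    refine ((((hasDerivAt_partialFst (contDiff_partialFst H.smooth) x s).fun_mul (hφ x)).fun_sub
      ((hasDerivAt_partialFst H.smooth x s).fun_mul (hφ' x))).const_mul (-(3 / 4))).congr_deriv ?_
    rw [hpt, affineCurvature]
    field_simp
    ring
  obtain ⟨M, hM⟩ := (isCompact_Icc (a := (0 : ℝ)) (b := t)).exists_bound_of_continuousOn
    (f := fun s => 3 / 4 * c s)
    fun s hs => ((H.hasDerivAt_mean hs.1).continuousAt.const_mul _).continuousWithinAt
  refine eq_zero_of_abs_deriv_le_mul_abs_self_of_eq_zero_right (K := M)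
    (fun s hs => (hderiv s hs.1).continuousAt.continuousWithinAt)
    (fun s hs => (hderiv s hs.1).hasDerivWithinAt) hzero (fun s hs => ?_) t ⟨ht, le_rfl⟩
  rw [norm_mul]
  exact mul_le_mul_of_nonneg_right (hM s ⟨hs.1, hs.2.le⟩) (norm_nonneg _)

lemma affineMetric (H : NormalizedAffineFlow U c) {t : ℝ} (ht : 0 ≤ t) :
    AffineMetric (fun x => U (x, t)) (fun x => partialFst U (x, t))
      (fun x => partialFst (partialFst U) (x, t)) (fun x => affineCurvature U (x, t))
      (fun x => partialFst (affineCurvature U) (x, t)) where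
  pos x := H.pos (x, t)
  per_v x := H.periodic x t
  per_v₁ x := partialFst_periodic H.smooth H.periodic x t
  per_k x := H.curvature_periodic x t
  deriv_v x := hasDerivAt_partialFst H.smooth x t
  deriv_v₁ x := hasDerivAt_partialFst (contDiff_partialFst H.smooth) x t
  deriv_k x := hasDerivAt_partialFst H.contDiff_curvature x t
  cont_v₂ := (contDiff_partialFst (contDiff_partialFst H.smooth)).continuous.comp (by fun_prop)
  cont_k₁ := (H.continuous_slices t).2.2.2
  k_eq _ := rfl
  mass := H.length_eq ht

lemma mean_le_one (H : NormalizedAffineFlow U c) {t : ℝ} (ht : 0 ≤ t) : c t ≤ 1 := by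
  refine le_one_of_riccati (γ := 1 / 8) (fun s hs => H.hasDerivAt_mean hs)
    (fun s _ => ?_) (by norm_num) (fun s hs hc => ?_) ht
  · refine mul_nonneg (by positivity) (intervalIntegral.integral_nonneg two_pi_pos.le fun x _ => ?_)
    exact mul_nonneg (sq_nonneg _) (inv_nonneg.2 (sq_nonneg _))
  · have h := (H.affineMetric hs).sq_sub_one_le hc
    rw [one_div_mul_eq_div (4 * π), le_div_iff₀ (by positivity)]
    linarith

theorem exists_exp_decay (H : NormalizedAffineFlow U c)
    (hcos : ∫ x in (0 : ℝ)..(2 * π), (U (x, 0) ^ 3)⁻¹ * cos x = 0)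
    (hsin : ∫ x in (0 : ℝ)..(2 * π), (U (x, 0) ^ 3)⁻¹ * sin x = 0) :
    ∃ C a : ℝ, 0 < C ∧ 0 < a ∧ ∀ t, 0 ≤ t →
      ∫ x in (0 : ℝ)..(2 * π), (affineCurvature U (x, t) - c t) ^ 2 * (U (x, t) ^ 2)⁻¹ ≤
        C * exp (-a * t) := by
  obtain ⟨t₀, ht₀, hsmall⟩ := exists_lt_of_deriv_of_le (γ := 1 / (4 * π)) (by positivity)
    (fun t ht => H.hasDerivAt_mean ht) (fun t ht => H.mean_le_one ht)
    (ε := 1 / 10 ^ 9) (by norm_num)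
  refine exp_decay_of_small (fun t ht => H.hasDerivAt_integral_sq_curvature_sub_mean ht)
    (ε := 1 / 10 ^ 9) (by norm_num) (fun t ht hE => ?_) ht₀ hsmall.le
  refine (H.affineMetric ht).integral_dissipation_le ?_ ?_ (H.mean_le_one ht)
    (H.integral_curvature_sub_mean t) hE
  · exact H.integral_cube_mul_eq_zero hasDerivAt_cos (fun x => (hasDerivAt_sin x).neg)
      contDiff_cos (by simp) (by simp) hcos ht
  · exact H.integral_cube_mul_eq_zero hasDerivAt_sin hasDerivAt_cos
      contDiff_sin (by simp) (by simp) hsin ht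

end NormalizedAffineFlow

/-- Exponential decay of the L² curvature deviation along the normalized
affine flow on S¹: `∫ (κ − κ̄)² dσ ≤ C e^{−at}`. -/
theorem affine_flow_exponential_decay
    (u : ℝ → ℝ → ℝ)
    (hu : ContDiff ℝ (⊤ : ℕ∞) (fun p : ℝ × ℝ => u p.1 p.2))
    (huper : ∀ θ t, u (θ + 2 * π) t = u θ t)
    (hupos : ∀ θ t, 0 < u θ t)
    (kappa : ℝ → ℝ → ℝ)
    (hkappa : ∀ θ t, kappa θ t = (u θ t) ^ 3 * (deriv (deriv (fun x => u x t)) θ + u θ t))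
    (kbar : ℝ → ℝ)
    (hkbar : ∀ t, kbar t =
      (∫ θ in (0:ℝ)..(2 * π), kappa θ t * ((u θ t) ^ 2)⁻¹) /
        ∫ θ in (0:ℝ)..(2 * π), ((u θ t) ^ 2)⁻¹)
    (hflow : ∀ θ t, 0 ≤ t →
      deriv (fun s => u θ s) t = (1 / 4) * (kappa θ t - kbar t) * u θ t)
    (hnorm : ∫ θ in (0:ℝ)..(2 * π), ((u θ 0) ^ 2)⁻¹ = 2 * π)
    (horth0c : ∫ θ in (0:ℝ)..(2 * π), ((u θ 0) ^ 3)⁻¹ * Real.cos θ = 0)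
    (horth0s : ∫ θ in (0:ℝ)..(2 * π), ((u θ 0) ^ 3)⁻¹ * Real.sin θ = 0) :
    ∃ C a : ℝ, 0 < C ∧ 0 < a ∧
      ∀ t : ℝ, 0 ≤ t →
        (∫ θ in (0:ℝ)..(2 * π), (kappa θ t - kbar t) ^ 2 * ((u θ t) ^ 2)⁻¹)
          ≤ C * Real.exp (-a * t) := by
  have hkap : ∀ θ t, kappa θ t = affineCurvature (fun p : ℝ × ℝ => u p.1 p.2) (θ, t) := by
    intro θ t
    have h : deriv (fun x => u x t) = fun x => partialFst (fun p : ℝ × ℝ => u p.1 p.2) (x, t) :=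
      funext fun x => (hasDerivAt_partialFst hu x t).deriv
    rw [hkappa, h, (hasDerivAt_partialFst (contDiff_partialFst hu) θ t).deriv]
    rfl
  simp only [hkap] at hkbar hflow ⊢
  exact NormalizedAffineFlow.exists_exp_decay (U := fun p => u p.1 p.2)
    ⟨hu, huper, fun p => hupos p.1 p.2, hkbar,
      fun θ t ht => (hasDerivAt_partialSnd hu θ t).deriv.symm.trans (hflow θ t ht), hnorm⟩
    horth0c horth0s
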